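/- arXiv:1301.6540 — 3 statements merged into one kernel-verified Lean document; each statement's English description precedes it below -/
import Mathlib

section
/- Concentration around the mean: for every ε > 0, both (#{π ∈ Π_n : |cr^ℓ(π) − E(X_n)| > ε·E(X_n)})/B_n → 0 and (#{π ∈ Π_n : |cr^c(π) − E(Y_n)| > ε·E(Y_n)})/B_n → 0 as n → ∞; i.e., the distributions of cr^ℓ and cr^c on a uniform random partition of [n] are concentrated around their means. -/
open Finset

/-- Two elements lie in the same block of the set partition `π` of `[n]`. -/
def sameBlock {n : ℕ} (π : Finpartition (univ : Finset (Fin n))) (a b : Fin n) : Prop :=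
  ∃ B ∈ π.parts, a ∈ B ∧ b ∈ B

/-- `(a, b)` is an arc of `π`: `a < b`, they lie in a common block, and no element of that
block lies strictly between them. -/
def IsArc {n : ℕ} (π : Finpartition (univ : Finset (Fin n))) (a b : Fin n) : Prop :=
  a < b ∧ sameBlock π a b ∧ ∀ c : Fin n, a < c → c < b → ¬ sameBlock π a c

/-- The linear crossing number `cr^ℓ(π)`: the number of pairs of arcs
`((a,b),(c,d))` with `a < c < b < d`. -/
noncomputable def crl {n : ℕ} (π : Finpartition (univ : Finset (Fin n))) : ℕ :=
  Set.ncard {q : (Fin n × Fin n) × (Fin n × Fin n) |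
    IsArc π q.1.1 q.1.2 ∧ IsArc π q.2.1 q.2.2 ∧
    q.1.1 < q.2.1 ∧ q.2.1 < q.1.2 ∧ q.1.2 < q.2.2}

/-- `(a, b)` is a chord of `π`: `a < b` lie in a common block `B`, and either they are
consecutive elements of `B`, or `B` has at least 3 elements and `a = min B`, `b = max B`. -/
def IsChord {n : ℕ} (π : Finpartition (univ : Finset (Fin n))) (a b : Fin n) : Prop :=
  a < b ∧ ∃ B ∈ π.parts, a ∈ B ∧ b ∈ B ∧
    ((∀ c ∈ B, ¬(a < c ∧ c < b)) ∨ (3 ≤ B.card ∧ ∀ c ∈ B, a ≤ c ∧ c ≤ b))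

/-- The circular crossing number `cr^c(π)`: the number of unordered pairs of crossing chords,
counted as ordered pairs `((a,b),(c,d))` of chords with `a < c < b < d`. -/
noncomputable def crc {n : ℕ} (π : Finpartition (univ : Finset (Fin n))) : ℕ :=
  Set.ncard {q : (Fin n × Fin n) × (Fin n × Fin n) |
    IsChord π q.1.1 q.1.2 ∧ IsChord π q.2.1 q.2.2 ∧
    q.1.1 < q.2.1 ∧ q.2.1 < q.1.2 ∧ q.1.2 < q.2.2}

/-- The Stirling number of the second kind `S(n,k)`: the number of set partitions of `[n]`
into exactly `k` blocks. -/
noncomputable def stirling (n k : ℕ) : ℕ :=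
  Nat.card {π : Finpartition (univ : Finset (Fin n)) // π.parts.card = k}

/-- Stirling numbers with integer arguments: `S(m,j) = 0` unless `0 ≤ j ≤ m`. -/
noncomputable def stirlingZ (m j : ℤ) : ℕ :=
  if 0 ≤ m ∧ 0 ≤ j then stirling m.toNat j.toNat else 0

/-- The Bell number `B_n`: the number of set partitions of `[n]`. -/
noncomputable def bell (n : ℕ) : ℕ :=
  Nat.card (Finpartition (univ : Finset (Fin n)))

/-- The set partitions of `[n]` with exactly `k` blocks, as a `Finset`. -/
def Pik (n k : ℕ) : Finset (Finpartition (univ : Finset (Fin n))) :=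
  Finset.univ.filter fun π => π.parts.card = k

/-- The mean of the linear crossing number over `Π_n^k`. -/
noncomputable def EX (n k : ℕ) : ℝ :=
  (∑ π ∈ Pik n k, (crl π : ℝ)) / stirling n k

/-- The variance of the linear crossing number over `Π_n^k`. -/
noncomputable def VarX (n k : ℕ) : ℝ :=
  (∑ π ∈ Pik n k, (crl π : ℝ) ^ 2) / stirling n k - EX n k ^ 2

/-- The mean of the circular crossing number over `Π_n^k`. -/
noncomputable def EY (n k : ℕ) : ℝ :=
  (∑ π ∈ Pik n k, (crc π : ℝ)) / stirling n k

/-- The variance of the circular crossing number over `Π_n^k`. -/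
noncomputable def VarY (n k : ℕ) : ℝ :=
  (∑ π ∈ Pik n k, (crc π : ℝ) ^ 2) / stirling n k - EY n k ^ 2

/-- The mean of the linear crossing number over all of `Π_n`. -/
noncomputable def EXall (n : ℕ) : ℝ :=
  (∑ π : Finpartition (univ : Finset (Fin n)), (crl π : ℝ)) / bell n

/-- The variance of the linear crossing number over all of `Π_n`. -/
noncomputable def VarXall (n : ℕ) : ℝ :=
  (∑ π : Finpartition (univ : Finset (Fin n)), (crl π : ℝ) ^ 2) / bell n - EXall n ^ 2

/-- The mean of the circular crossing number over all of `Π_n`. -/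
noncomputable def EYall (n : ℕ) : ℝ :=
  (∑ π : Finpartition (univ : Finset (Fin n)), (crc π : ℝ)) / bell n

/-- The variance of the circular crossing number over all of `Π_n`. -/
noncomputable def VarYall (n : ℕ) : ℝ :=
  (∑ π : Finpartition (univ : Finset (Fin n)), (crc π : ℝ) ^ 2) / bell n - EYall n ^ 2

/-- The standard normal distribution function `Φ`. -/
noncomputable def stdNormalCDF (x : ℝ) : ℝ :=
  (Real.sqrt (2 * Real.pi))⁻¹ * ∫ t in Set.Iic x, Real.exp (-t ^ 2 / 2)

/-! ### Words and their kernel partitions -/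

section Kernel

variable {n m : ℕ}

theorem sameBlock_iff_part_eq (π : Finpartition (univ : Finset (Fin n))) (a b : Fin n) :
    sameBlock π a b ↔ π.part a = π.part b := by
  rw [← π.mem_part_iff_part_eq_part (mem_univ a) (mem_univ b), π.mem_part_iff_exists]
  rfl

theorem finpartition_ext_sameBlock {π σ : Finpartition (univ : Finset (Fin n))}
    (h : ∀ a b, sameBlock π a b ↔ sameBlock σ a b) : π = σ := by
  have hpart : ∀ a, π.part a = σ.part a := fun a => by
    ext b
    rw [π.mem_part_iff_exists, σ.mem_part_iff_exists]
    exact h b a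
  have hsub : ∀ {π σ : Finpartition (univ : Finset (Fin n))}, (∀ a, π.part a = σ.part a) →
      π.parts ⊆ σ.parts := fun {π σ} hp B hB => by
    obtain ⟨a, ha⟩ := π.nonempty_of_mem_parts hB
    rw [← π.part_eq_of_mem hB ha, hp a]
    exact σ.part_mem.2 (mem_univ a)
  exact Finpartition.ext (Subset.antisymm (hsub hpart) (hsub fun a => (hpart a).symm))

open Classical in
/-- The set partition of the positions of a word according to the letter they carry. -/
noncomputable def kerPartition (f : Fin n → Fin m) : Finpartition (univ : Finset (Fin n)) :=
  Finpartition.ofSetoid (Setoid.ker f)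

theorem sameBlock_kerPartition (f : Fin n → Fin m) (a b : Fin n) :
    sameBlock (kerPartition f) a b ↔ f a = f b := by
  classical
  rw [sameBlock_iff_part_eq,
    ← Finpartition.mem_part_iff_part_eq_part _ (mem_univ a) (mem_univ b), kerPartition,
    Finpartition.mem_part_ofSetoid_iff_rel]
  exact eq_comm

theorem kerPartition_eq_iff (f : Fin n → Fin m) (π : Finpartition (univ : Finset (Fin n))) :
    kerPartition f = π ↔ ∀ a b, π.part a = π.part b ↔ f a = f b := by
  constructor
  · rintro rfl a b
    rw [← sameBlock_iff_part_eq, sameBlock_kerPartition]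
  · intro h
    refine finpartition_ext_sameBlock fun a b => ?_
    rw [sameBlock_kerPartition, sameBlock_iff_part_eq, h]

/-- A partition with `k` blocks is the kernel of `m (m - 1) ⋯ (m - k + 1)` words over `m`
letters. -/
theorem card_kerPartition_fiber (π : Finpartition (univ : Finset (Fin n))) (m : ℕ) :
    #{f : Fin n → Fin m | kerPartition f = π} = m.descFactorial #π.parts := by
  classical
  have hcard : m.descFactorial #π.parts = #(univ : Finset (π.parts ↪ Fin m)) := by
    rw [card_univ, Fintype.card_embedding_eq, Fintype.card_fin, Fintype.card_coe]
  rw [hcard]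
  symm
  have hmem : ∀ a, π.part a ∈ π.parts := fun a => π.part_mem.2 (mem_univ a)
  refine card_bij (fun e _ a => e ⟨π.part a, hmem a⟩) ?_ ?_ ?_
  · intro e _
    simp only [mem_filter, mem_univ, true_and, kerPartition_eq_iff]
    intro a b
    simp
  · intro e _ e' _ h
    ext ⟨B, hB⟩ : 1
    obtain ⟨a, ha⟩ := π.nonempty_of_mem_parts hB
    have := congrFun h a
    simpa only [π.part_eq_of_mem hB ha] using this
  · intro f hf
    simp only [mem_filter, mem_univ, true_and, kerPartition_eq_iff] at hf
    choose r hr using fun B : π.parts => π.nonempty_of_mem_parts B.2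
    have hrp : ∀ B : π.parts, π.part (r B) = B := fun B => π.part_eq_of_mem B.2 (hr B)
    refine ⟨⟨fun B => f (r B), fun B B' h => ?_⟩, mem_univ _, ?_⟩
    · have := (hf _ _).2 h
      rw [hrp, hrp] at this
      exact Subtype.ext this
    · funext a
      exact (hf _ _).1 (hrp _)

theorem hasSum_of_eq {f g : ℕ → ℝ} {a b : ℝ} (h : HasSum f a) (hf : ∀ m, g m = f m)
    (hab : b = a) : HasSum g b := by
  rw [hab, funext hf]
  exact h

theorem hasSum_descFactorial_div_factorial (k : ℕ) :
    HasSum (fun m : ℕ => (m.descFactorial k : ℝ) / m.factorial) (Real.exp 1) := by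
  have h1 : HasSum (fun m : ℕ => (1 : ℝ) / m.factorial) (Real.exp 1) := by
    have := NormedSpace.expSeries_div_hasSum_exp (1 : ℝ)
    rw [← Real.exp_eq_exp_ℝ] at this
    simpa using this
  rw [← hasSum_nat_add_iff' k]
  have h0 : ∑ i ∈ range k, ((i.descFactorial k : ℕ) : ℝ) / i.factorial = 0 := by
    refine sum_eq_zero fun i hi => ?_
    rw [Nat.descFactorial_of_lt (mem_range.1 hi)]
    simp
  rw [h0, sub_zero]
  refine hasSum_of_eq h1 (fun m => ?_) rfl
  have := Nat.factorial_mul_descFactorial (n := m + k) (k := k) (by omega)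
  rw [Nat.add_sub_cancel] at this
  rw [← this]
  have h2 : ((m.factorial : ℕ) : ℝ) ≠ 0 := by positivity
  have h3 : (((m + k).descFactorial k : ℕ) : ℝ) ≠ 0 := by
    have := Nat.pow_sub_le_descFactorial (m + k) k
    have h4 : 0 < (m + k + 1 - k) ^ k := by
      apply pow_pos; omega
    exact_mod_cast (by omega : (m + k).descFactorial k ≠ 0)
  push_cast
  field_simp

/-- Dobinski's formula for the sum of a statistic over all set partitions of `[n]`. -/
theorem hasSum_sum_kerPartition (F : Finpartition (univ : Finset (Fin n)) → ℝ) :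
    HasSum (fun m : ℕ => (∑ f : Fin n → Fin m, F (kerPartition f)) / m.factorial)
      (Real.exp 1 * ∑ π, F π) := by
  have h : ∀ m : ℕ, (∑ f : Fin n → Fin m, F (kerPartition f)) / m.factorial =
      ∑ π, F π * ((m.descFactorial #π.parts : ℝ) / m.factorial) := fun m => by
    classical
    rw [← sum_fiberwise univ (fun f : Fin n → Fin m => kerPartition f), sum_div]
    refine sum_congr rfl fun π _ => ?_
    rw [sum_congr rfl (g := fun _ => F π) (fun f hf => by rw [(mem_filter.1 hf).2]),
      sum_const, ← card_kerPartition_fiber, nsmul_eq_mul]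
    ring
  simp only [h]
  rw [mul_comm, sum_mul]
  exact hasSum_sum fun π _ => (hasSum_descFactorial_div_factorial _).mul_left _

/-- Dobinski's formula. -/
theorem hasSum_bell (n : ℕ) :
    HasSum (fun m : ℕ => (m : ℝ) ^ n / m.factorial) (Real.exp 1 * bell n) := by
  have h := hasSum_sum_kerPartition (n := n) (fun _ => 1)
  simpa [bell] using h

end Kernel

/-! ### Ratios of consecutive Bell numbers -/

section Bell

theorem bell_pos (n : ℕ) : (0 : ℝ) < bell n := by
  have : 0 < bell n := Nat.card_pos
  exact_mod_cast this

/-- The ratio `B_{n+1} / B_n`. -/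
noncomputable def bellRatio (n : ℕ) : ℝ := bell (n + 1) / bell n

theorem bellRatio_pos (n : ℕ) : 0 < bellRatio n := div_pos (bell_pos _) (bell_pos _)

theorem bell_succ_eq_mul (n : ℕ) : (bell (n + 1) : ℝ) = bellRatio n * bell n := by
  rw [bellRatio, div_mul_cancel₀ _ (bell_pos n).ne']

/-- The second moment about `t` of the Dobinski weights. -/
theorem hasSum_sq_sub (n : ℕ) (t : ℝ) :
    HasSum (fun m : ℕ => (m : ℝ) ^ n * (m - t) ^ 2 / m.factorial)
      (Real.exp 1 *
        (bell n * (bellRatio n * bellRatio (n + 1) - 2 * t * bellRatio n + t ^ 2))) := by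
  have h := ((hasSum_bell (n + 2)).sub ((hasSum_bell (n + 1)).mul_left (2 * t))).add
    ((hasSum_bell n).mul_left (t ^ 2))
  rw [bell_succ_eq_mul (n + 1), bell_succ_eq_mul n] at h
  exact hasSum_of_eq h (fun m => by ring) (by ring)

theorem bellRatio_mono : Monotone bellRatio := by
  refine monotone_nat_of_le_succ fun n => ?_
  have h := (hasSum_sq_sub n (bellRatio n)).nonneg fun m => by positivity
  have h1 := nonneg_of_mul_nonneg_right h (Real.exp_pos 1)
  have h2 := nonneg_of_mul_nonneg_right h1 (bell_pos n)
  have h3 : 0 ≤ bellRatio n * (bellRatio (n + 1) - bellRatio n) := by linarith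
  linarith [nonneg_of_mul_nonneg_right h3 (bellRatio_pos n)]

theorem bell_succ_eq_sum (n : ℕ) :
    (bell (n + 1) : ℝ) = ∑ j ∈ range (n + 1), (n.choose j : ℝ) * bell j := by
  have h1 := (hasSum_nat_add_iff' 1).2 (hasSum_bell (n + 1))
  have h2 : HasSum
      (fun m : ℕ => ∑ j ∈ range (n + 1), (n.choose j : ℝ) * ((m : ℝ) ^ j / m.factorial))
      (∑ j ∈ range (n + 1), (n.choose j : ℝ) * (Real.exp 1 * bell j)) :=
    hasSum_sum fun j _ => (hasSum_bell j).mul_left _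
  have h3 := h1.unique (hasSum_of_eq h2 (fun m => ?_) rfl)
  swap
  ·
    have hm : ((m + 1 : ℕ) : ℝ) ≠ 0 := by positivity
    have hf : ((m.factorial : ℕ) : ℝ) ≠ 0 := by positivity
    rw [Nat.factorial_succ, pow_succ, Nat.cast_mul]
    have : ((m + 1 : ℕ) : ℝ) ^ n = ∑ j ∈ range (n + 1), (n.choose j : ℝ) * (m : ℝ) ^ j := by
      push_cast
      rw [add_pow]
      refine sum_congr rfl fun j _ => ?_
      simp [mul_comm]
    rw [mul_comm ((m + 1 : ℕ) : ℝ), mul_div_mul_right _ _ hm, this, sum_div]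
    exact sum_congr rfl fun j _ => by ring
  have h4 : Real.exp 1 * (bell (n + 1) : ℝ) =
      Real.exp 1 * ∑ j ∈ range (n + 1), (n.choose j : ℝ) * bell j := by
    rw [mul_sum, ← sub_zero (Real.exp 1 * (bell (n + 1) : ℝ))]
    convert h3 using 1
    · simp
    · exact sum_congr rfl fun j _ => by ring
  exact mul_left_cancel₀ (Real.exp_pos 1).ne' h4

theorem bellRatio_succ_le (n : ℕ) : bellRatio (n + 1) ≤ bellRatio n + 1 := by
  have h : (bell (n + 2) : ℝ) ≤ (bellRatio n + 1) * bell (n + 1) := by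
    have h1 : (bell (n + 2) : ℝ) =
        ∑ j ∈ range (n + 1), (n.choose j : ℝ) * (bell j + bell (j + 1)) := by
      rw [bell_succ_eq_sum (n + 1), sum_range_succ']
      simp only [Nat.choose_succ_succ, Nat.cast_add, add_mul, sum_add_distrib, mul_add]
      rw [sum_range_succ (fun j => (n.choose (j + 1) : ℝ) * bell (j + 1)),
        sum_range_succ' (fun j => (n.choose j : ℝ) * bell j)]
      simp
      ring
    rw [h1, bell_succ_eq_sum n, mul_sum]
    refine sum_le_sum fun j hj => ?_
    have hle := bellRatio_mono (Nat.lt_succ_iff.1 (mem_range.1 hj))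
    have hb := mul_le_mul_of_nonneg_right hle (bell_pos j).le
    rw [bell_succ_eq_mul j]
    calc (n.choose j : ℝ) * (bell j + bellRatio j * bell j)
        ≤ (n.choose j : ℝ) * (bell j + bellRatio n * bell j) := by gcongr
      _ = _ := by ring
  rw [bellRatio, div_le_iff₀ (bell_pos _)]
  exact h

theorem le_bellRatio_sq (n : ℕ) : (n : ℝ) ≤ bellRatio n ^ 2 := by
  rcases n with _ | n
  · simpa using sq_nonneg _
  have h1 : ((n + 1 : ℕ) : ℝ) * bell n ≤ bell (n + 1 + 1) := by
    rw [bell_succ_eq_sum (n + 1)]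
    have h := single_le_sum (f := fun j => ((n + 1).choose j : ℝ) * bell j)
      (fun j _ => by positivity) (mem_range.2 (by omega : n < n + 1 + 1))
    simpa only [Nat.choose_succ_self_right] using h
  rw [bell_succ_eq_mul (n + 1), bell_succ_eq_mul n, ← mul_assoc] at h1
  have h2 := le_of_mul_le_mul_right h1 (bell_pos n)
  refine h2.trans ?_
  rw [sq]
  exact mul_le_mul_of_nonneg_left (bellRatio_mono n.le_succ) (bellRatio_pos _).le

theorem tendsto_bellRatio_atTop : Filter.Tendsto bellRatio Filter.atTop Filter.atTop := by
  have h : Filter.Tendsto (fun n : ℕ => Real.sqrt n) Filter.atTop Filter.atTop :=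
    Real.tendsto_sqrt_atTop.comp tendsto_natCast_atTop_atTop
  refine Filter.tendsto_atTop_mono (fun n => ?_) h
  exact Real.sqrt_le_iff.2 ⟨(bellRatio_pos n).le, le_bellRatio_sq n⟩

theorem bellRatio_add_le (n t : ℕ) : bellRatio (n + t) ≤ bellRatio n + t := by
  induction t with
  | zero => simp
  | succ t ih =>
    have := bellRatio_succ_le (n + t)
    push_cast
    rw [← add_assoc] at *
    linarith

theorem bellRatio_pow_mul_bell_le (n t : ℕ) : bellRatio n ^ t * bell n ≤ bell (n + t) := by
  induction t with
  | zero => simp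
  | succ t ih =>
    rw [← add_assoc, bell_succ_eq_mul, pow_succ]
    have h1 := bellRatio_mono (Nat.le_add_right n t)
    have h2 := bellRatio_pos n
    calc bellRatio n ^ t * bellRatio n * bell n
        = bellRatio n * (bellRatio n ^ t * bell n) := by ring
      _ ≤ bellRatio (n + t) * bell (n + t) := by
        have := bellRatio_pos (n + t)
        gcongr

/-- Few blocks are large and, when `B_{n+1} / B_n` is of order `n`, few blocks are small. -/
theorem mul_bellRatio_le (n s : ℕ) (δ : ℝ) (hδ : 0 < δ) (hs : (s : ℝ) ≤ δ * n / 2)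
    (hn : δ * n ≤ bellRatio n) :
    s * bellRatio n ≤ n + s * ∑ t ∈ range s, (2 / δ) ^ t := by
  have hB := bell_pos n
  have hmean : ∑ t ∈ range (n + 1), (t : ℝ) * ((n.choose t : ℝ) * bell (n - t)) = n * bell n := by
    rcases n with _ | n
    · simp
    rw [sum_range_succ', bell_succ_eq_sum n, mul_sum, ← sum_range_reflect]
    simp only [Nat.cast_zero, zero_mul, add_zero]
    refine sum_congr rfl fun j hj => ?_
    have hj' := mem_range.1 hj
    rw [show n + 1 - 1 - j = n - j by omega, show n + 1 - (n - j + 1) = j by omega,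
      ← Nat.choose_symm (by omega : j ≤ n)]
    have h2 : ((n + 1 : ℕ) : ℝ) * (n.choose (n - j) : ℝ) =
        ((n + 1).choose (n - j + 1) : ℝ) * ((n - j + 1 : ℕ) : ℝ) := by
      exact_mod_cast Nat.add_one_mul_choose_eq n (n - j)
    rw [← mul_assoc, ← mul_assoc, h2]
    ring
  have htot : ∑ t ∈ range (n + 1), (n.choose t : ℝ) * bell (n - t) = bellRatio n * bell n := by
    rw [← bell_succ_eq_mul, bell_succ_eq_sum, ← sum_range_reflect]
    refine sum_congr rfl fun j hj => ?_
    have hj' := mem_range.1 hj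
    rw [show n + 1 - 1 - j = n - j by omega, show n - (n - j) = j by omega,
      Nat.choose_symm (by omega : j ≤ n)]
  have hsmall : ∀ t ∈ range s, t ≤ n → (n.choose t : ℝ) * bell (n - t) ≤ (2 / δ) ^ t * bell n := by
    intro t ht htn
    have hts : (t : ℝ) ≤ s := by exact_mod_cast (mem_range.1 ht).le
    have h1 := bellRatio_add_le (n - t) t
    rw [Nat.sub_add_cancel htn] at h1
    have h2 : δ * n / 2 ≤ bellRatio (n - t) := by linarith
    have h3 := bellRatio_pow_mul_bell_le (n - t) t
    rw [Nat.sub_add_cancel htn] at h3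
    calc (n.choose t : ℝ) * bell (n - t) ≤ (n : ℝ) ^ t * bell (n - t) := by
          gcongr
          exact_mod_cast Nat.choose_le_pow n t
      _ = (2 / δ) ^ t * ((δ * n / 2) ^ t * bell (n - t)) := by
          rw [← mul_assoc, ← mul_pow]
          congr 2
          field_simp
      _ ≤ (2 / δ) ^ t * (bellRatio (n - t) ^ t * bell (n - t)) := by gcongr
      _ ≤ _ := by gcongr
  have key : s * (bellRatio n * bell n) ≤
      n * bell n + s * ((∑ t ∈ range s, (2 / δ) ^ t) * bell n) := by
    have hterm : ∀ t ∈ range (n + 1), (s : ℝ) * ((n.choose t : ℝ) * bell (n - t)) ≤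
        t * ((n.choose t : ℝ) * bell (n - t)) +
          (if t ∈ range s then s * ((2 / δ) ^ t * bell n) else 0) := by
      intro t ht
      have h0 : 0 ≤ (n.choose t : ℝ) * bell (n - t) := by positivity
      split_ifs with h
      · have := hsmall t h (Nat.lt_succ_iff.1 (mem_range.1 ht))
        have h1 : 0 ≤ (t : ℝ) * ((n.choose t : ℝ) * bell (n - t)) := by positivity
        have h2 := mul_le_mul_of_nonneg_left this (Nat.cast_nonneg (α := ℝ) s)
        linarith
      · have : (s : ℝ) ≤ t := by exact_mod_cast not_lt.1 (fun h' => h (mem_range.2 h'))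
        rw [add_zero]
        gcongr
    rw [← htot, ← hmean, mul_sum]
    refine (sum_le_sum hterm).trans ?_
    rw [sum_add_distrib, sum_mul, mul_sum]
    gcongr
    rw [← sum_filter]
    refine sum_le_sum_of_subset_of_nonneg ?_ ?_
    · intro t ht
      exact (mem_filter.1 ht).2
    · intros
      positivity
  refine le_of_mul_le_mul_right ?_ hB
  linarith

theorem tendsto_bellRatio_div :
    Filter.Tendsto (fun n : ℕ => bellRatio n / n) Filter.atTop (nhds 0) := by
  rw [Metric.tendsto_atTop]
  intro δ hδ
  obtain ⟨s, hs⟩ := exists_nat_gt (2 / δ)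
  set C := (s : ℝ) * ∑ t ∈ range s, (2 / δ) ^ t
  obtain ⟨N, hN⟩ := exists_nat_gt (max C (2 * s / δ))
  refine ⟨N + 1, fun n hn => ?_⟩
  have hn' : max C (2 * s / δ) < n := hN.trans (by exact_mod_cast (by omega : N < n))
  have hn0 : (0 : ℝ) < n := by exact_mod_cast (by omega : 0 < n)
  rw [Real.dist_eq, sub_zero, abs_of_nonneg (div_nonneg (bellRatio_pos n).le hn0.le),
    div_lt_iff₀ hn0]
  by_contra! hcon
  have h1 : 2 * s / δ < n := (le_max_right _ _).trans_lt hn'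
  have h2 : C < n := (le_max_left _ _).trans_lt hn'
  rw [div_lt_iff₀ hδ] at h1 hs
  have h3 := mul_bellRatio_le n s δ hδ (by linarith) hcon
  have h4 : (s : ℝ) * (δ * n) ≤ s * bellRatio n := by gcongr
  have h5 : 2 * n < s * δ * n := by gcongr
  linarith

end Bell

/-! ### Linear versus circular crossings -/

section Chords

variable {n m : ℕ}

theorem isArc_kerPartition_iff (f : Fin n → Fin m) (a b : Fin n) :
    IsArc (kerPartition f) a b ↔ a < b ∧ f a = f b ∧ ∀ c, a < c → c < b → f a ≠ f c := by
  simp only [IsArc, sameBlock_kerPartition, ne_eq]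

theorem IsArc.isChord {π : Finpartition (univ : Finset (Fin n))} {a b : Fin n}
    (h : IsArc π a b) : IsChord π a b := by
  obtain ⟨hab, ⟨B, hB, ha, hb⟩, hc⟩ := h
  exact ⟨hab, B, hB, ha, hb, Or.inl fun c hcB hc' => hc c hc'.1 hc'.2 ⟨B, hB, ha, hcB⟩⟩

/-- `a` and `b` are the extreme positions of a letter of the word `f`. -/
def IsSpan (f : Fin n → Fin m) (a b : Fin n) : Prop :=
  f a = f b ∧ ∀ c, f a = f c → a ≤ c ∧ c ≤ b

theorem IsChord.isArc_or_isSpan {f : Fin n → Fin m} {a b : Fin n}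
    (h : IsChord (kerPartition f) a b) : IsArc (kerPartition f) a b ∨ IsSpan f a b := by
  obtain ⟨hab, B, hB, ha, hb, hc⟩ := h
  have hmem : ∀ c, f a = f c → c ∈ B := fun c hfc => by
    obtain ⟨B', hB', ha', hc'⟩ := (sameBlock_kerPartition f a c).2 hfc
    rwa [(kerPartition f).eq_of_mem_parts hB hB' ha ha']
  have hf : f a = f b := (sameBlock_kerPartition f a b).1 ⟨B, hB, ha, hb⟩
  rcases hc with hc | ⟨_, hc⟩
  · refine Or.inl ((isArc_kerPartition_iff f a b).2 ⟨hab, hf, fun c h1 h2 h3 => ?_⟩)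
    exact hc c (hmem c h3) ⟨h1, h2⟩
  · exact Or.inr ⟨hf, fun c h => hc c (hmem c h)⟩

theorem IsSpan.unique {f : Fin n → Fin m} {a b a' b' : Fin n} (h : IsSpan f a b)
    (h' : IsSpan f a' b') (hf : f a = f a') : a = a' ∧ b = b' := by
  have h1 := h.2 a' hf
  have h2 := h.2 b' (hf.trans h'.1)
  have h3 := h'.2 a hf.symm
  have h4 := h'.2 b (hf.symm.trans h.1)
  exact ⟨le_antisymm h1.1 h3.1, le_antisymm h4.2 h2.2⟩

theorem IsArc.unique_of_straddle {f : Fin n → Fin m} {c d c' d' x : Fin n}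
    (h : IsArc (kerPartition f) c d) (h' : IsArc (kerPartition f) c' d') (hf : f c = f c')
    (hc : c < x) (hd : x < d) (hc' : c' < x) (hd' : x < d') : c = c' ∧ d = d' := by
  rw [isArc_kerPartition_iff] at h h'
  obtain ⟨-, he, hn⟩ := h
  obtain ⟨-, he', hn'⟩ := h'
  constructor
  · rcases lt_trichotomy c c' with hlt | heq | hlt
    · exact absurd hf (hn c' hlt (hc'.trans hd))
    · exact heq
    · exact absurd hf.symm (hn' c hlt (hc.trans hd'))
  · rcases lt_trichotomy d d' with hlt | heq | hlt
    · exact absurd (hf.symm.trans he) (hn' d (hc'.trans hd) hlt)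
    · exact heq
    · exact absurd (hf.trans he') (hn d' (hc.trans hd') hlt)

theorem crl_le_crc (π : Finpartition (univ : Finset (Fin n))) : crl π ≤ crc π :=
  Set.ncard_le_ncard (fun _ hq => ⟨hq.1.isChord, hq.2.1.isChord, hq.2.2⟩) (Set.toFinite _)

theorem ncard_le_sq_of_injOn {α : Type*} {s : Set α} (g : α → Fin m × Fin m)
    (hg : Set.InjOn g s) : s.ncard ≤ m ^ 2 := by
  have := Set.ncard_le_ncard_of_injOn (t := Set.univ) g (fun _ _ => Set.mem_univ _) hg
  rwa [Set.ncard_univ, Nat.card_eq_fintype_card, Fintype.card_prod, Fintype.card_fin, ← sq] at this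

/-- A crossing that uses a chord joining the extreme elements of a block is determined by the
kinds of its two chords and their two letters. -/
theorem crc_kerPartition_le (f : Fin n → Fin m) :
    crc (kerPartition f) ≤ crl (kerPartition f) + 3 * m ^ 2 := by
  let cross : Set ((Fin n × Fin n) × (Fin n × Fin n)) :=
    {q | q.1.1 < q.2.1 ∧ q.2.1 < q.1.2 ∧ q.1.2 < q.2.2}
  let L : Set ((Fin n × Fin n) × (Fin n × Fin n)) := {q |
    IsArc (kerPartition f) q.1.1 q.1.2 ∧ IsArc (kerPartition f) q.2.1 q.2.2 ∧
    q.1.1 < q.2.1 ∧ q.2.1 < q.1.2 ∧ q.1.2 < q.2.2}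
  let U : Set ((Fin n × Fin n) × (Fin n × Fin n)) := {q |
    IsSpan f q.1.1 q.1.2 ∧ IsArc (kerPartition f) q.2.1 q.2.2 ∧ q ∈ cross}
  let V : Set ((Fin n × Fin n) × (Fin n × Fin n)) := {q |
    IsSpan f q.1.1 q.1.2 ∧ IsSpan f q.2.1 q.2.2}
  let W : Set ((Fin n × Fin n) × (Fin n × Fin n)) := {q |
    IsArc (kerPartition f) q.1.1 q.1.2 ∧ IsSpan f q.2.1 q.2.2 ∧ q ∈ cross}
  let g : (Fin n × Fin n) × (Fin n × Fin n) → Fin m × Fin m := fun q => (f q.1.1, f q.2.1)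
  have hU : U.ncard ≤ m ^ 2 := ncard_le_sq_of_injOn g <| by
    rintro ⟨⟨a, b⟩, c, d⟩ ⟨h1, h2, -, h4, h5⟩ ⟨⟨a', b'⟩, c', d'⟩ ⟨h1', h2', -, h4', h5'⟩ he
    obtain ⟨rfl, rfl⟩ := h1.unique h1' (congrArg Prod.fst he)
    obtain ⟨rfl, rfl⟩ := h2.unique_of_straddle h2' (congrArg Prod.snd he) h4 h5 h4' h5'
    rfl
  have hV : V.ncard ≤ m ^ 2 := ncard_le_sq_of_injOn g <| by
    rintro ⟨⟨a, b⟩, c, d⟩ ⟨h1, h2⟩ ⟨⟨a', b'⟩, c', d'⟩ ⟨h1', h2'⟩ he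
    obtain ⟨rfl, rfl⟩ := h1.unique h1' (congrArg Prod.fst he)
    obtain ⟨rfl, rfl⟩ := h2.unique h2' (congrArg Prod.snd he)
    rfl
  have hW : W.ncard ≤ m ^ 2 := ncard_le_sq_of_injOn g <| by
    rintro ⟨⟨a, b⟩, c, d⟩ ⟨h1, h2, h3, h4, -⟩ ⟨⟨a', b'⟩, c', d'⟩ ⟨h1', h2', h3', h4', -⟩ he
    obtain ⟨rfl, rfl⟩ := h2.unique h2' (congrArg Prod.snd he)
    obtain ⟨rfl, rfl⟩ := h1.unique_of_straddle h1' (congrArg Prod.fst he) h3 h4 h3' h4'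
    rfl
  have hsub : crc (kerPartition f) ≤ (L ∪ (U ∪ (V ∪ W))).ncard := by
    refine Set.ncard_le_ncard ?_ (Set.toFinite _)
    rintro q ⟨h1, h2, h3⟩
    rcases h1.isArc_or_isSpan with h1 | h1 <;> rcases h2.isArc_or_isSpan with h2 | h2
    · exact Or.inl ⟨h1, h2, h3⟩
    · exact Or.inr (Or.inr (Or.inr ⟨h1, h2, h3⟩))
    · exact Or.inr (Or.inl ⟨h1, h2, h3⟩)
    · exact Or.inr (Or.inr (Or.inl ⟨h1, h2⟩))
  have h1 := Set.ncard_union_le L (U ∪ (V ∪ W))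
  have h2 := Set.ncard_union_le U (V ∪ W)
  have h3 := Set.ncard_union_le V W
  have hL : L.ncard = crl (kerPartition f) := rfl
  omega

end Chords

/-! ### Move-to-front ranks of the letters of a word -/

section Ranks

variable {n m : ℕ}

/-- A measure of how recently the letter `x` was read before position `b`. Letters not yet read
are older than all the others. -/
def recency (f : Fin n → Fin m) (b : Fin n) (x : Fin m) : ℕ :=
  ({a | a < b ∧ f a = x} : Finset (Fin n)).sup (fun a => (a : ℕ) + m) ⊔ (x : ℕ)

theorem recency_of_unseen {f : Fin n → Fin m} {b : Fin n} {x : Fin m}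
    (h : ∀ a < b, f a ≠ x) : recency f b x = x := by
  rw [recency, filter_eq_empty_iff.2]
  · simp
  · rintro a - ⟨h1, h2⟩
    exact h a h1 h2

theorem recency_of_last {f : Fin n → Fin m} {a b : Fin n} (hab : a < b)
    (h : ∀ c, a < c → c < b → f a ≠ f c) : recency f b (f a) = a + m := by
  refine le_antisymm ?_ ?_
  · refine sup_le (Finset.sup_le fun c hc => ?_) (by omega)
    obtain ⟨-, hcb, hfc⟩ := mem_filter.1 hc
    have : c ≤ a := not_lt.1 fun hac => h c hac hcb hfc.symm
    have : (c : ℕ) ≤ a := this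
    omega
  · refine le_trans ?_ le_sup_left
    exact le_sup (f := fun a : Fin n => (a : ℕ) + m)
      (mem_filter.2 ⟨mem_univ _, hab, rfl⟩ : a ∈ ({c | c < b ∧ f c = f a} : Finset (Fin n)))

theorem exists_last_lt (f : Fin n → Fin m) (b : Fin n) (x : Fin m) (h : ∃ a < b, f a = x) :
    ∃ a < b, f a = x ∧ ∀ c, a < c → c < b → f a ≠ f c := by
  obtain ⟨a₀, h₀⟩ := h
  obtain ⟨a, ha, hmax⟩ := exists_max_image ({a | a < b ∧ f a = x} : Finset (Fin n)) id
    ⟨a₀, mem_filter.2 ⟨mem_univ _, h₀⟩⟩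
  obtain ⟨-, hab, hfa⟩ := mem_filter.1 ha
  refine ⟨a, hab, hfa, fun c hac hcb hfc => ?_⟩
  exact absurd (hmax c (mem_filter.2 ⟨mem_univ _, hcb, hfc ▸ hfa⟩)) (not_le.2 hac)

theorem exists_first_gt (f : Fin n → Fin m) (b : Fin n) (x : Fin m) (h : ∃ a > b, f a = x) :
    ∃ a > b, f a = x ∧ ∀ c, b < c → c < a → f a ≠ f c := by
  obtain ⟨a₀, h₀⟩ := h
  obtain ⟨a, ha, hmin⟩ := exists_min_image ({a | a > b ∧ f a = x} : Finset (Fin n)) id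
    ⟨a₀, mem_filter.2 ⟨mem_univ _, h₀⟩⟩
  obtain ⟨-, hab, hfa⟩ := mem_filter.1 ha
  refine ⟨a, hab, hfa, fun c hbc hca hfc => ?_⟩
  exact absurd (hmin c (mem_filter.2 ⟨mem_univ _, hbc, hfc ▸ hfa⟩)) (not_le.2 hca)

theorem recency_cases (f : Fin n → Fin m) (b : Fin n) (x : Fin m) :
    ((∀ a < b, f a ≠ x) ∧ recency f b x = x) ∨
      ∃ a < b, f a = x ∧ (∀ c, a < c → c < b → f a ≠ f c) ∧ recency f b x = a + m := by
  by_cases h : ∃ a < b, f a = x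
  · obtain ⟨a, hab, rfl, hc⟩ := exists_last_lt f b x h
    exact Or.inr ⟨a, hab, rfl, hc, recency_of_last hab hc⟩
  · push Not at h
    exact Or.inl ⟨h, recency_of_unseen h⟩

theorem recency_injective (f : Fin n → Fin m) (b : Fin n) : Function.Injective (recency f b) := by
  intro x y hxy
  rcases recency_cases f b x with ⟨-, hx⟩ | ⟨a, -, hax, -, hx⟩ <;>
    rcases recency_cases f b y with ⟨-, hy⟩ | ⟨c, -, hcy, -, hy⟩
  · exact Fin.ext (by omega)
  · omega
  · omega
  · rw [← hax, ← hcy, (Fin.ext (by omega) : a = c)]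

/-- The position of the letter `f b` in the move-to-front list of the letters at time `b`. -/
def mtfRank (f : Fin n → Fin m) (b : Fin n) : ℕ := #{y | recency f b (f b) < recency f b y}

theorem sum_card_filter_eq {α β : Type*} [Fintype α] [Fintype β] (p : α → β → Prop)
    [∀ a, DecidablePred (p a)] :
    ∑ a, #{b | p a b} = Set.ncard {q : α × β | p q.1 q.2} := by
  classical
  rw [Set.ncard_eq_toFinset_card', Set.toFinset_ofPred, card_filter, Fintype.sum_prod_type]
  exact sum_congr rfl fun a _ => card_filter _ _

theorem crl_kerPartition_le (f : Fin n → Fin m) : crl (kerPartition f) ≤ ∑ b, mtfRank f b := by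
  simp only [mtfRank]
  rw [sum_card_filter_eq]
  refine Set.ncard_le_ncard_of_injOn (fun q => (q.1.2, f q.2.1)) ?_ ?_ (Set.toFinite _)
  · rintro ⟨⟨a, b⟩, c, d⟩ ⟨h1, h2, hac, hcb, hbd⟩
    rw [isArc_kerPartition_iff] at h1 h2
    dsimp only at h1 h2 hac hcb hbd
    change recency f b (f b) < recency f b (f c)
    rw [← h1.2.1, recency_of_last h1.1 h1.2.2,
      recency_of_last hcb fun e hce heb => h2.2.2 e hce (heb.trans hbd)]
    have : (a : ℕ) < c := hac
    omega
  · rintro ⟨⟨a, b⟩, c, d⟩ ⟨h1, h2, hac, hcb, hbd⟩ ⟨⟨a', b'⟩, c', d'⟩ ⟨h1', h2', hac', hcb', hbd'⟩ he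
    obtain rfl : b = b' := congrArg Prod.fst he
    obtain ⟨rfl, rfl⟩ := h2.unique_of_straddle h2' (congrArg Prod.snd he) hcb hbd hcb' hbd'
    rw [isArc_kerPartition_iff] at h1 h1'
    have hf : f a = f a' := h1.2.1.trans h1'.2.1.symm
    rcases lt_trichotomy a a' with hlt | rfl | hlt
    · exact absurd hf (h1.2.2 a' hlt h1'.1)
    · rfl
    · exact absurd hf.symm (h1'.2.2 a hlt h1.1)

theorem sum_mtfRank_le (f : Fin n → Fin m) :
    ∑ b, mtfRank f b ≤
      crl (kerPartition f) + m ^ 2 + #{q : Fin n × Fin m | ∀ d > q.1, f d ≠ q.2} := by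
  classical
  simp only [mtfRank]
  rw [sum_card_filter_eq]
  let L : Set ((Fin n × Fin n) × (Fin n × Fin n)) := {q |
    IsArc (kerPartition f) q.1.1 q.1.2 ∧ IsArc (kerPartition f) q.2.1 q.2.2 ∧
    q.1.1 < q.2.1 ∧ q.2.1 < q.1.2 ∧ q.1.2 < q.2.2}
  let g : (Fin n × Fin n) × (Fin n × Fin n) → Fin n × Fin m := fun q => (q.1.2, f q.2.1)
  let U : Set (Fin n × Fin m) := {q | ∀ a < q.1, f a ≠ f q.1}
  let V : Set (Fin n × Fin m) := {q | ∀ d > q.1, f d ≠ q.2}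
  have hsub : {q : Fin n × Fin m | recency f q.1 (f q.1) < recency f q.1 q.2} ⊆
      g '' L ∪ (U ∪ V) := by
    rintro ⟨b, y⟩ hby
    change recency f b (f b) < recency f b y at hby
    rcases recency_cases f b (f b) with ⟨h, -⟩ | ⟨a, hab, hfa, ha, hra⟩
    · exact Or.inr (Or.inl h)
    by_cases hy : ∀ d > b, f d ≠ y
    · exact Or.inr (Or.inr hy)
    push Not at hy
    obtain ⟨d, hbd, hfd, hd⟩ := exists_first_gt f b y hy
    rcases recency_cases f b y with ⟨-, hr⟩ | ⟨c, hcb, hfc, hc, hrc⟩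
    · omega
    refine Or.inl ⟨((a, b), (c, d)), ⟨?_, ?_, ?_, hcb, hbd⟩, by simp only [g, hfc]⟩
    · exact (isArc_kerPartition_iff f a b).2 ⟨hab, hfa, ha⟩
    · refine (isArc_kerPartition_iff f c d).2 ⟨hcb.trans hbd, hfc.trans hfd.symm, ?_⟩
      intro e hce hed
      rcases lt_trichotomy e b with hlt | rfl | hlt
      · exact hc e hce hlt
      · rintro hfe
        rw [← hfe, hfc] at hby
        exact lt_irrefl _ hby
      · rw [hfc, ← hfd]
        exact hd e hlt hed
    · change (a : ℕ) < c
      omega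
  have hU : U.ncard ≤ m ^ 2 := by
    refine ncard_le_sq_of_injOn (fun q => (f q.1, q.2)) ?_
    rintro ⟨b, y⟩ h ⟨b', y'⟩ h' he
    have h1 : f b = f b' := congrArg Prod.fst he
    have h2 : y = y' := congrArg Prod.snd he
    rcases lt_trichotomy b b' with hlt | rfl | hlt
    · exact absurd h1 (h' b hlt)
    · rw [h2]
    · exact absurd h1.symm (h b' hlt)
  have hV : V.ncard = #{q : Fin n × Fin m | ∀ d > q.1, f d ≠ q.2} := by
    rw [Set.ncard_eq_toFinset_card', Set.toFinset_ofPred]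
  have h1 := Set.ncard_le_ncard hsub (Set.toFinite _)
  have h2 := Set.ncard_union_le (g '' L) (U ∪ V)
  have h3 := Set.ncard_union_le U V
  have h4 : (g '' L).ncard ≤ L.ncard := Set.ncard_image_le (Set.toFinite _)
  have hL : L.ncard = crl (kerPartition f) := rfl
  omega

/-- On average over all words, few letters are missing from the end of the word. -/
theorem sum_card_missing_le (n m : ℕ) :
    ∑ f : Fin n → Fin m, #{q : Fin n × Fin m | ∀ d > q.1, f d ≠ q.2} ≤ m ^ n * m ^ 2 := by
  classical
  rw [sum_card_filter_eq]
  have hinj : Set.InjOn (fun p : (Fin n → Fin m) × (Fin n × Fin m) =>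
      (Function.update p.1 p.2.1 p.2.2, p.2.2, p.1 p.2.1))
      {p | ∀ d > p.2.1, p.1 d ≠ p.2.2} := by
    rintro ⟨f, b, y⟩ h ⟨f', b', y'⟩ h' he
    simp only [Prod.mk.injEq] at he
    obtain ⟨hg, rfl, hz⟩ := he
    change ∀ d > b, f d ≠ y at h
    change ∀ d > b', f' d ≠ y at h'
    have hb : b = b' := by
      rcases lt_trichotomy b b' with hlt | heq | hlt
      · have := congrFun hg b'
        rw [Function.update_self, Function.update_of_ne hlt.ne'] at this
        exact absurd this (h b' hlt)
      · exact heq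
      · have := congrFun hg b
        rw [Function.update_self, Function.update_of_ne hlt.ne'] at this
        exact absurd this.symm (h' b hlt)
    subst hb
    have hf : f = f' := by
      have h1 : f = Function.update (Function.update f b y) b (f b) := by simp
      rw [h1, hg, hz]
      simp
    rw [hf]
  have := Set.ncard_le_ncard_of_injOn (t := Set.univ) _ (fun _ _ => Set.mem_univ _) hinj
  refine this.trans ?_
  rw [Set.ncard_univ, Nat.card_eq_fintype_card]
  simp [sq]

/-! ### The variance of the sum of the ranks -/

theorem recency_update {b i : Fin n} (h : b ≤ i) (f : Fin n → Fin m) (x : Fin m) :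
    recency (Function.update f i x) b = recency f b := by
  funext y
  rw [recency, recency]
  congr 2
  refine filter_congr fun a _ => and_congr_right fun hab => ?_
  rw [Function.update_of_ne (hab.trans_le h).ne]

theorem sum_sum_update {ι α : Type*} [Fintype ι] [DecidableEq ι] [Fintype α]
    (G : (ι → α) → ℝ) (i : ι) :
    ∑ f : ι → α, ∑ x, G (Function.update f i x) = Fintype.card α * ∑ f, G f := by
  let e : (ι → α) × α ≃ (ι → α) × α :=
    { toFun := fun p => (Function.update p.1 i p.2, p.1 i)
      invFun := fun p => (Function.update p.1 i p.2, p.1 i)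
      left_inv := fun p => by simp
      right_inv := fun p => by simp }
  rw [← Fintype.sum_prod_type' (fun f x => G (Function.update f i x)),
    show ∑ p : (ι → α) × α, G (Function.update p.1 i p.2) = ∑ p : (ι → α) × α, G p.1 from
      Equiv.sum_comp e fun p : (ι → α) × α => G p.1, Fintype.sum_prod_type, mul_sum]
  simp

/-- The deviation of a move-to-front rank from its mean. -/
noncomputable def rankDev (f : Fin n → Fin m) (b : Fin n) : ℝ := mtfRank f b - ((m : ℝ) - 1) / 2

theorem sum_card_lt_of_injective {α : Type*} [Fintype α] (r : α → ℕ) (hr : Function.Injective r) :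
    2 * ∑ x, (#{y | r x < r y} : ℝ) = Fintype.card α * (Fintype.card α - 1) := by
  classical
  have hsymm : ∑ x, (#{y | r x < r y} : ℝ) = ∑ x, (#{y | r y < r x} : ℝ) := by
    simp only [card_filter, Nat.cast_sum]
    exact sum_comm
  have hx : ∀ x, (#{y | r x < r y} : ℝ) + #{y | r y < r x} = Fintype.card α - 1 := fun x => by
    have h1 := card_filter_add_card_filter_not (s := univ.erase x) (fun y => r x < r y)
    have e1 : (univ.erase x).filter (fun y => r x < r y) = ({y | r x < r y} : Finset α) := by
      ext y
      simp only [mem_filter, mem_erase, mem_univ, and_true, true_and, and_iff_right_iff_imp]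
      rintro h rfl
      exact lt_irrefl _ h
    have e2 : (univ.erase x).filter (fun y => ¬ r x < r y) = ({y | r y < r x} : Finset α) := by
      ext y
      simp only [mem_filter, mem_erase, mem_univ, and_true, true_and, not_lt]
      constructor
      · rintro ⟨h, h'⟩
        exact lt_of_le_of_ne h' fun h'' => h (hr h'')
      · intro h
        exact ⟨fun h' => by rw [h'] at h; exact lt_irrefl _ h, h.le⟩
    rw [e1, e2, card_erase_of_mem (mem_univ x), card_univ] at h1
    have : 0 < Fintype.card α := Fintype.card_pos_iff.2 ⟨x⟩
    have h2 : #{y | r x < r y} + #{y | r y < r x} + 1 = Fintype.card α := by omega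
    rw [← h2]
    push_cast
    ring
  rw [two_mul]
  nth_rewrite 2 [hsymm]
  rw [← sum_add_distrib, sum_congr rfl fun x _ => hx x]
  simp only [sum_const, card_univ, nsmul_eq_mul]

theorem sum_rankDev_update (f : Fin n → Fin m) (b : Fin n) :
    ∑ x, rankDev (Function.update f b x) b = 0 := by
  simp only [rankDev, mtfRank, recency_update le_rfl, Function.update_self, sum_sub_distrib]
  have := sum_card_lt_of_injective _ (recency_injective f b)
  rw [Fintype.card_fin] at this
  simp only [sum_const, card_univ, Fintype.card_fin, nsmul_eq_mul]
  linarith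

theorem sum_rankDev_mul_of_lt {b b' : Fin n} (h : b < b') :
    ∑ f : Fin n → Fin m, rankDev f b * rankDev f b' = 0 := by
  rcases Nat.eq_zero_or_pos m with rfl | hm
  · exact sum_eq_zero fun f _ => (f b).elim0
  have h1 := sum_sum_update (fun f : Fin n → Fin m => rankDev f b * rankDev f b') b'
  have h2 : ∀ (f : Fin n → Fin m) (x : Fin m), rankDev (Function.update f b' x) b = rankDev f b :=
    fun f x => by
      simp only [rankDev, mtfRank, recency_update h.le, Function.update_of_ne h.ne]
  simp only [h2, ← mul_sum, sum_rankDev_update, mul_zero, sum_const_zero, Fintype.card_fin] at h1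
  have hm' : (m : ℝ) ≠ 0 := by positivity
  exact (mul_eq_zero.1 h1.symm).resolve_left hm'

theorem rankDev_sq_le (f : Fin n → Fin m) (b : Fin n) : rankDev f b ^ 2 ≤ (m : ℝ) ^ 2 := by
  have hm : 0 < m := (f b).pos
  have hm' : (1 : ℝ) ≤ m := by exact_mod_cast hm
  have h : mtfRank f b ≤ m := by
    refine (card_le_univ _).trans_eq ?_
    rw [Fintype.card_fin]
  have h' : (mtfRank f b : ℝ) ≤ m := by exact_mod_cast h
  have h0 : (0 : ℝ) ≤ mtfRank f b := by positivity
  rw [rankDev]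
  refine sq_le_sq' ?_ ?_ <;> linarith

theorem sum_sq_sum_rankDev_le (n m : ℕ) :
    ∑ f : Fin n → Fin m, (∑ b, rankDev f b) ^ 2 ≤ (m : ℝ) ^ n * (n * m ^ 2) := by
  have h : ∀ b b' : Fin n, ∑ f : Fin n → Fin m, rankDev f b * rankDev f b' ≤
      if b = b' then (m : ℝ) ^ n * m ^ 2 else 0 := fun b b' => by
    split_ifs with hb
    · subst hb
      refine (sum_le_sum fun f _ => ?_).trans (b := ∑ _f : Fin n → Fin m, (m : ℝ) ^ 2) ?_
      · rw [← sq]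
        exact rankDev_sq_le f b
      · simp
    · rcases lt_or_gt_of_ne hb with hlt | hlt
      · exact (sum_rankDev_mul_of_lt hlt).le
      · simp only [mul_comm (rankDev _ b)]
        exact (sum_rankDev_mul_of_lt hlt).le
  calc ∑ f : Fin n → Fin m, (∑ b, rankDev f b) ^ 2
      = ∑ b, ∑ b', ∑ f : Fin n → Fin m, rankDev f b * rankDev f b' := by
        simp only [sq, sum_mul_sum]
        rw [sum_comm]
        exact sum_congr rfl fun b _ => sum_comm
    _ ≤ ∑ b : Fin n, ∑ b', if b = b' then (m : ℝ) ^ n * m ^ 2 else 0 :=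
        sum_le_sum fun b _ => sum_le_sum fun b' _ => h b b'
    _ = _ := by
        simp
        ring

end Ranks

/-! ### Concentration -/

section Concentration

theorem sum_abs_sub_word_le {n : ℕ} (hn : 0 < n)
    (F : Finpartition (univ : Finset (Fin n)) → ℝ) (m : ℕ)
    (hF : ∀ f : Fin n → Fin m, |F (kerPartition f) - crl (kerPartition f)| ≤ 3 * m ^ 2) (c : ℝ) :
    ∑ f : Fin n → Fin m, |F (kerPartition f) - c| ≤
      (m : ℝ) ^ n * (6 * m ^ 2 + n / 2 + |(n : ℝ) * (m - 1) / 2 - c|) := by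
  have hn' : (0 : ℝ) < n := by exact_mod_cast hn
  let T : (Fin n → Fin m) → ℝ := fun f => #{q : Fin n × Fin m | ∀ d > q.1, f d ≠ q.2}
  have hpt : ∀ f : Fin n → Fin m, |F (kerPartition f) - c| ≤
      (4 * (m : ℝ) ^ 2 + n / 2 + |(n : ℝ) * (m - 1) / 2 - c|) + T f +
        (∑ b, rankDev f b) ^ 2 / (2 * n) := fun f => by
    have h1 : (crl (kerPartition f) : ℝ) ≤ ∑ b, (mtfRank f b : ℝ) := by
      exact_mod_cast crl_kerPartition_le f
    have h2 : ∑ b, (mtfRank f b : ℝ) ≤ crl (kerPartition f) + (m : ℝ) ^ 2 + T f := by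
      simp only [T]
      exact_mod_cast sum_mtfRank_le f
    have h3 : ∑ b, rankDev f b = ∑ b, (mtfRank f b : ℝ) - (n : ℝ) * (m - 1) / 2 := by
      simp only [rankDev, sum_sub_distrib, sum_const, card_univ, Fintype.card_fin, nsmul_eq_mul]
      ring
    have h4 : |∑ b, rankDev f b| ≤ (∑ b, rankDev f b) ^ 2 / (2 * n) + n / 2 := by
      rw [← sq_abs (∑ b, rankDev f b), div_add_div _ _ (by positivity) (by positivity),
        le_div_iff₀ (by positivity)]
      nlinarith [sq_nonneg (|∑ b, rankDev f b| - n)]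
    have h5 := hF f
    have h6 := le_abs_self ((n : ℝ) * (m - 1) / 2 - c)
    have h7 := neg_abs_le ((n : ℝ) * (m - 1) / 2 - c)
    have h8 := abs_le.1 h4
    rw [abs_le] at h5
    rw [h3] at h8 ⊢
    have hsq : 0 ≤ (m : ℝ) ^ 2 := by positivity
    have hT : 0 ≤ T f := Nat.cast_nonneg _
    rw [abs_le]
    constructor <;> linarith
  have hT : ∑ f, T f ≤ (m : ℝ) ^ n * m ^ 2 := by
    simp only [T]
    exact_mod_cast sum_card_missing_le n m
  have hV : ∑ f : Fin n → Fin m, (∑ b, rankDev f b) ^ 2 / (2 * n) ≤ (m : ℝ) ^ n * (m ^ 2 / 2) := by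
    rw [← sum_div, div_le_iff₀ (by positivity)]
    refine (sum_sq_sum_rankDev_le n m).trans_eq ?_
    ring
  refine (sum_le_sum fun f _ => hpt f).trans ?_
  rw [sum_add_distrib, sum_add_distrib]
  simp only [sum_const, card_univ, Fintype.card_fun, Fintype.card_fin, nsmul_eq_mul]
  push_cast
  have : (0 : ℝ) ≤ (m : ℝ) ^ n * m ^ 2 := by positivity
  linarith

/-- A statistic close to the linear crossing number is, in mean, close to `n B_{n+1} / (2 B_n)`. -/
theorem sum_abs_sub_le {n : ℕ} (hn : 0 < n) (F : Finpartition (univ : Finset (Fin n)) → ℝ)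
    (hF : ∀ (m : ℕ) (f : Fin n → Fin m),
      |F (kerPartition f) - crl (kerPartition f)| ≤ 3 * m ^ 2) :
    ∑ π, |F π - n * bellRatio n / 2| ≤ bell n *
      ((12 * (bellRatio (n + 1) / n) + 2 * (bellRatio n)⁻¹ + (Real.sqrt (bellRatio n))⁻¹) *
        (n * bellRatio n / 2)) := by
  have hn' : (0 : ℝ) < n := by exact_mod_cast hn
  set ρ := bellRatio n with hρ
  have hρ0 : 0 < ρ := bellRatio_pos n
  set t := Real.sqrt ρ with ht
  have ht0 : 0 < t := Real.sqrt_pos.2 hρ0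
  have htt : ρ = t ^ 2 := (Real.sq_sqrt hρ0.le).symm
  have h1 := hasSum_sum_kerPartition (n := n) fun π => |F π - n * ρ / 2|
  have h2 := ((hasSum_sq_sub n 0).mul_left 6).add
    (((hasSum_bell n).mul_left (n + n * t / 4)).add ((hasSum_sq_sub n ρ).mul_left (n / (4 * t))))
  have h3 := hasSum_le (fun m => ?_) h1 h2
  · have h4 : Real.exp 1 * ∑ π, |F π - n * ρ / 2| ≤ Real.exp 1 * (bell n *
        (6 * (ρ * bellRatio (n + 1)) + (n + n * t / 4) +
          n / (4 * t) * (ρ * (bellRatio (n + 1) - ρ)))) := by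
      refine h3.trans_eq ?_
      rw [← hρ]
      ring
    refine (le_of_mul_le_mul_left h4 (Real.exp_pos 1)).trans ?_
    refine mul_le_mul_of_nonneg_left ?_ (bell_pos n).le
    have h5 : ρ * (bellRatio (n + 1) - ρ) ≤ ρ * 1 := by
      have := bellRatio_succ_le n
      gcongr
      linarith
    have h6 : n / (4 * t) * (ρ * (bellRatio (n + 1) - ρ)) ≤ n / (4 * t) * (ρ * 1) := by gcongr
    refine (add_le_add le_rfl h6).trans_eq ?_
    rw [htt]
    field_simp
    ring
  · have hm := sum_abs_sub_word_le hn F m (hF m) (n * ρ / 2)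
    have hfac : (0 : ℝ) < m.factorial := by positivity
    rw [← mul_div_assoc, ← mul_div_assoc, ← mul_div_assoc, ← add_div, ← add_div,
      div_le_div_iff_of_pos_right hfac]
    refine hm.trans ?_
    have h7 : |(n : ℝ) * (m - 1) / 2 - n * ρ / 2| ≤
        n / 2 + n * t / 4 + n / (4 * t) * (m - ρ) ^ 2 := by
      have h8 : |(m : ℝ) - ρ| ≤ (m - ρ) ^ 2 / (2 * t) + t / 2 := by
        rw [← sq_abs ((m : ℝ) - ρ), div_add_div _ _ (by positivity) (by positivity),
          le_div_iff₀ (by positivity)]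
        nlinarith [sq_nonneg (|(m : ℝ) - ρ| - t)]
      have h9 : |(n : ℝ) * (m - 1) / 2 - n * ρ / 2| ≤ n / 2 * (|(m : ℝ) - ρ| + 1) := by
        rw [show (n : ℝ) * (m - 1) / 2 - n * ρ / 2 = n / 2 * ((m - ρ) - 1) by ring, abs_mul,
          abs_of_pos (by positivity : (0 : ℝ) < n / 2)]
        gcongr
        simpa using abs_sub (m - ρ) 1
      refine h9.trans ?_
      have h10 : (n : ℝ) / 2 * (|(m : ℝ) - ρ| + 1) ≤
          n / 2 * ((m - ρ) ^ 2 / (2 * t) + t / 2 + 1) := by gcongr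
      refine h10.trans_eq ?_
      field_simp
      ring
    have h11 : (m : ℝ) ^ n * (6 * m ^ 2 + n / 2 + |(n : ℝ) * (m - 1) / 2 - n * ρ / 2|) ≤
        (m : ℝ) ^ n * (6 * m ^ 2 + n / 2 +
          (n / 2 + n * t / 4 + n / (4 * t) * (m - ρ) ^ 2)) := by gcongr
    refine h11.trans_eq ?_
    ring

/-- Markov's inequality for statistics whose mean absolute deviation from `c` is at most
`δ c`. -/
theorem card_deviation_div_le {n : ℕ} (F : Finpartition (univ : Finset (Fin n)) → ℝ)
    {c δ ε : ℝ} (hc : 0 < c) (hε : 0 < ε) (hδ : δ * (1 + ε) ≤ ε / 2)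
    (h : ∑ π, |F π - c| ≤ bell n * (δ * c)) :
    (Nat.card {π // |F π - (∑ σ, F σ) / bell n| > ε * ((∑ σ, F σ) / bell n)} : ℝ) / bell n ≤
      2 / ε * δ := by
  classical
  have hB := bell_pos n
  set μ := (∑ σ, F σ) / (bell n : ℝ) with hμ
  have hμc : |μ - c| ≤ δ * c := by
    have : μ - c = (∑ π, (F π - c)) / bell n := by
      rw [sum_sub_distrib, sub_div, hμ]
      congr 1
      rw [sum_const, card_univ, nsmul_eq_mul, ← Nat.card_eq_fintype_card]
      change c = bell n * c / bell n
      field_simp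
    rw [this, abs_div, abs_of_pos hB, div_le_iff₀ hB]
    refine (abs_sum_le_sum_abs _ _).trans (h.trans_eq ?_)
    ring
  have hfar : ∀ π, |F π - μ| > ε * μ → ε / 2 * c ≤ |F π - c| := fun π hπ => by
    have h1 : |F π - μ| ≤ |F π - c| + |μ - c| := by
      rw [abs_sub_comm μ c]
      exact abs_sub_le _ _ _
    have h2 : ε * (c - δ * c) ≤ ε * μ := by
      have := (abs_le.1 hμc).1
      gcongr
      linarith
    have h3 := mul_le_mul_of_nonneg_right hδ hc.le
    linarith
  rw [Nat.card_eq_fintype_card, Fintype.card_subtype]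
  have hmarkov : (#{π | |F π - μ| > ε * μ} : ℝ) * (ε / 2 * c) ≤ bell n * (δ * c) := by
    refine le_trans ?_ h
    rw [← nsmul_eq_mul, ← sum_const]
    refine (sum_le_sum fun π hπ => hfar π (mem_filter.1 hπ).2).trans ?_
    exact sum_le_sum_of_subset_of_nonneg (subset_univ _) fun _ _ _ => abs_nonneg _
  rw [div_le_iff₀ hB]
  have h4 : (#{π | |F π - μ| > ε * μ} : ℝ) * (ε / 2) ≤ bell n * δ := by
    refine le_of_mul_le_mul_right ?_ hc
    linarith
  calc (#{π | |F π - μ| > ε * μ} : ℝ) = 2 / ε * (#{π | |F π - μ| > ε * μ} * (ε / 2)) := by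
        field_simp
    _ ≤ 2 / ε * (bell n * δ) := by gcongr
    _ = _ := by ring

theorem tendsto_card_deviation_div
    (F : (n : ℕ) → Finpartition (univ : Finset (Fin n)) → ℝ)
    (hF : ∀ (n m : ℕ) (f : Fin n → Fin m),
      |F n (kerPartition f) - crl (kerPartition f)| ≤ 3 * m ^ 2) {ε : ℝ} (hε : 0 < ε) :
    Filter.Tendsto (fun n : ℕ => (Nat.card {π : Finpartition (univ : Finset (Fin n)) //
      |F n π - (∑ σ, F n σ) / bell n| > ε * ((∑ σ, F n σ) / bell n)} : ℝ) / (bell n : ℝ))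
      Filter.atTop (nhds 0) := by
  let δ : ℕ → ℝ := fun n =>
    12 * (bellRatio (n + 1) / n) + 2 * (bellRatio n)⁻¹ + (Real.sqrt (bellRatio n))⁻¹
  have hδ : Filter.Tendsto δ Filter.atTop (nhds 0) := by
    have h1 : Filter.Tendsto (fun n : ℕ => bellRatio (n + 1) / n) Filter.atTop (nhds 0) := by
      have h2 := tendsto_bellRatio_div.add (tendsto_one_div_atTop_nhds_zero_nat (𝕜 := ℝ))
      rw [add_zero] at h2
      refine squeeze_zero (fun n => div_nonneg (bellRatio_pos _).le n.cast_nonneg) (fun n => ?_) h2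
      rw [← add_div]
      gcongr
      exact bellRatio_succ_le n
    have h3 := tendsto_inv_atTop_zero.comp tendsto_bellRatio_atTop
    have h4 := tendsto_inv_atTop_zero.comp (Real.tendsto_sqrt_atTop.comp tendsto_bellRatio_atTop)
    have h5 := ((h1.const_mul 12).add (h3.const_mul 2)).add h4
    simpa using h5
  have hsmall : ∀ᶠ n in Filter.atTop, δ n * (1 + ε) ≤ ε / 2 := by
    have h1 := hδ.mul_const (1 + ε)
    rw [zero_mul] at h1
    exact h1.eventually_le_const (by positivity)
  have hlim := hδ.const_mul (2 / ε)
  rw [mul_zero] at hlim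
  refine squeeze_zero' (Filter.Eventually.of_forall fun n => by positivity) ?_ hlim
  filter_upwards [hsmall, Filter.eventually_gt_atTop 0] with n hn hn0
  have hn' : (0 : ℝ) < n := by exact_mod_cast hn0
  have := bellRatio_pos n
  exact card_deviation_div_le (F n) (by positivity : 0 < n * bellRatio n / 2) hε hn
    (sum_abs_sub_le hn0 (F n) (hF n))

end Concentration

/-- Concentration of the crossing numbers of a uniform random set partition around their means. -/
theorem concentration_cr (ε : ℝ) (hε : 0 < ε) :
    Filter.Tendsto (fun n : ℕ =>
        (Nat.card {π : Finpartition (univ : Finset (Fin n)) //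
            |(crl π : ℝ) - EXall n| > ε * EXall n} : ℝ) / (bell n : ℝ))
      Filter.atTop (nhds 0) ∧
    Filter.Tendsto (fun n : ℕ =>
        (Nat.card {π : Finpartition (univ : Finset (Fin n)) //
            |(crc π : ℝ) - EYall n| > ε * EYall n} : ℝ) / (bell n : ℝ))
      Filter.atTop (nhds 0) := by
  refine ⟨tendsto_card_deviation_div (fun _ π => (crl π : ℝ)) (fun n m f => ?_) hε,
    tendsto_card_deviation_div (fun _ π => (crc π : ℝ)) (fun n m f => ?_) hε⟩
  · rw [sub_self, abs_zero]
    positivity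
  · have h1 : (crl (kerPartition f) : ℝ) ≤ crc (kerPartition f) := by
      exact_mod_cast crl_le_crc _
    have h2 : (crc (kerPartition f) : ℝ) ≤ crl (kerPartition f) + 3 * (m : ℝ) ^ 2 := by
      exact_mod_cast crc_kerPartition_le f
    rw [abs_of_nonneg (by linarith)]
    linarith
end

section
/- Let M^c_{n,k} denote the maximum of cr^c(π) over all set partitions π of [n] into exactly k blocks. Then for integers n ≥ k ≥ 1: (a) if k ≤ n/3, then M^c_{n,k} = 2·C(k,2)·⌊n/k⌋ + 2·C(r,2) = (k−1)·n − r·(k−r), where r is the remainder of the division of n by k; (b) if n/3 ≤ k < n/2, or if n/2 ≤ k ≤ n−6, then, setting a = n−k, M^c_{n,k} = 6·C(⌊a/2⌋,2) + 2·⌊a/2⌋ when a is odd and M^c_{n,k} = 6·C(⌊a/2⌋,2) when a is even; (c) if k ≥ n−5 and k ≥ n/2, then M^c_{n,k} = C(n−k,2). -/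
open Finset

/-- The chords of a block `B`, as pairs `(a, b)` with `a < b`. -/
def blockChords {α : Type*} [LinearOrder α] (B : Finset α) : Finset (α × α) :=
  {e ∈ B ×ˢ B | e.1 < e.2 ∧
    ((∀ c ∈ B, ¬(e.1 < c ∧ c < e.2)) ∨ (3 ≤ B.card ∧ ∀ c ∈ B, e.1 ≤ c ∧ c ≤ e.2))}

/-- The chords `e` and `e'` cross, with `e` starting first. -/
abbrev CrossesRight {α : Type*} [LinearOrder α] (e e' : α × α) : Prop :=
  e.1 < e'.1 ∧ e'.1 < e.2 ∧ e.2 < e'.2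

section Blocks

variable {α : Type*} [LinearOrder α]

lemma mem_blockChords {B : Finset α} {a b : α} :
    (a, b) ∈ blockChords B ↔ (a ∈ B ∧ b ∈ B) ∧ a < b ∧
      ((∀ c ∈ B, ¬(a < c ∧ c < b)) ∨ (3 ≤ B.card ∧ ∀ c ∈ B, a ≤ c ∧ c ≤ b)) := by
  simp [blockChords]

lemma card_blockChords_le (B : Finset α) : (blockChords B).card ≤ B.card := by
  classical
  refine Finset.card_le_card_of_injOn
    (fun e => if ∀ c ∈ B, ¬(e.1 < c ∧ c < e.2) then e.1 else e.2) ?_ ?_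
  · rintro ⟨a, b⟩ h
    have h := mem_blockChords.1 h
    simp only
    split_ifs <;> simp [h.1]
  · rintro ⟨a, b⟩ h ⟨a', b'⟩ h' heq
    obtain ⟨⟨ha, hb⟩, hab, h⟩ := mem_blockChords.1 h
    obtain ⟨⟨ha', hb'⟩, hab', h'⟩ := mem_blockChords.1 h'
    simp only at heq
    rw [Prod.mk.injEq]
    split_ifs at heq with h₁ h₂ h₂
    · subst heq
      refine ⟨rfl, le_antisymm ?_ ?_⟩
      · by_contra! hlt
        exact h₁ _ hb' ⟨hab', hlt⟩
      · by_contra! hlt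
        exact h₂ _ hb ⟨hab, hlt⟩
    · have := ((h'.resolve_left h₂).2 _ hb).2
      exact absurd (hab.trans_le this) (by simp [heq])
    · have := ((h.resolve_left h₁).2 _ hb').2
      exact absurd (hab'.trans_le this) (by simp [heq])
    · have h := (h.resolve_left h₁).2
      have h' := (h'.resolve_left h₂).2
      exact ⟨le_antisymm (h _ ha').1 (h' _ ha).1, heq⟩

lemma card_blockChords_le_one {B : Finset α} (hB : B.card ≤ 2) : (blockChords B).card ≤ 1 := by
  rw [Finset.card_le_one]
  rintro ⟨a, b⟩ h ⟨a', b'⟩ h'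
  obtain ⟨⟨ha, hb⟩, hab, -⟩ := mem_blockChords.1 h
  obtain ⟨⟨ha', hb'⟩, hab', -⟩ := mem_blockChords.1 h'
  have hs : ({a, b} : Finset α) = B := Finset.eq_of_subset_of_card_le
    (by simp [Finset.insert_subset_iff, ha, hb]) (by rwa [Finset.card_pair hab.ne])
  rw [← hs] at ha' hb'
  simp only [Finset.mem_insert, Finset.mem_singleton] at ha' hb'
  grind

lemma card_blockChords_eq_zero {B : Finset α} (hB : B.card ≤ 1) : (blockChords B).card = 0 := by
  rw [Finset.card_eq_zero, Finset.eq_empty_iff_forall_notMem]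
  rintro ⟨a, b⟩ h
  obtain ⟨⟨ha, hb⟩, hab, -⟩ := mem_blockChords.1 h
  exact hab.ne (Finset.card_le_one.1 hB _ ha _ hb)

/-- A pair crosses at most two chords of `B`. -/
lemma card_crossing_le_two (B : Finset α) (c d : α) :
    {e ∈ blockChords B | CrossesRight e (c, d) ∨ CrossesRight (c, d) e}.card ≤ 2 := by
  classical
  refine le_trans (Finset.card_le_card_of_injOn (t := (Finset.univ : Finset Bool))
    (fun e => decide ((∀ x ∈ B, ¬(e.1 < x ∧ x < e.2)) ↔ e.1 < c))
    (fun _ _ => Finset.mem_univ _) ?_) (by simp)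
  rintro ⟨a, b⟩ h ⟨a', b'⟩ h' heq
  simp only [Finset.coe_filter, Set.mem_ofPred_eq, mem_blockChords] at h h'
  obtain ⟨⟨⟨ha, hb⟩, hab, h⟩, hx⟩ := h
  obtain ⟨⟨⟨ha', hb'⟩, hab', h'⟩, hx'⟩ := h'
  simp only [decide_eq_decide] at heq
  rw [Prod.mk.injEq]
  have key : ∀ {u v u' v' : α}, u ∈ B → v ∈ B → u' ∈ B → v' ∈ B → ∀ w, u < w → w < v → u' < w →
      w < v' → (∀ x ∈ B, ¬(u < x ∧ x < v)) → (∀ x ∈ B, ¬(u' < x ∧ x < v')) →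
      u = u' ∧ v = v' := by
    intro u v u' v' hu hv hu' hv' w h1 h2 h3 h4 h5 h6
    have e1 := h5 _ hu'
    have e2 := h5 _ hv'
    have e3 := h6 _ hu
    have e4 := h6 _ hv
    grind
  by_cases h₁ : ∀ x ∈ B, ¬(a < x ∧ x < b) <;> by_cases h₂ : ∀ x ∈ B, ¬(a' < x ∧ x < b')
  · by_cases hac : a < c
    · exact key ha hb ha' hb' c (by grind) (by grind) (by grind) (by grind) h₁ h₂
    · exact key ha hb ha' hb' d (by grind) (by grind) (by grind) (by grind) h₁ h₂
  · have h' := (h'.resolve_left h₂).2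
    have e1 := h' _ ha
    have e2 := h' _ hb
    grind
  · have h := (h.resolve_left h₁).2
    have e1 := h _ ha'
    have e2 := h _ hb'
    grind
  · have h := (h.resolve_left h₁).2
    have h' := (h'.resolve_left h₂).2
    exact ⟨le_antisymm (h _ ha').1 (h' _ ha).1, le_antisymm (h' _ hb).2 (h _ hb').2⟩

/-- The pairs of crossing chords of two blocks, the chord of the first block starting first. -/
def rightCrossings (A B : Finset α) : Finset ((α × α) × (α × α)) :=
  {q ∈ blockChords A ×ˢ blockChords B | CrossesRight q.1 q.2}

/-- The pairs of crossing chords of two blocks. -/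
def crossings (A B : Finset α) : Finset ((α × α) × (α × α)) :=
  {q ∈ blockChords A ×ˢ blockChords B | CrossesRight q.1 q.2 ∨ CrossesRight q.2 q.1}

lemma card_rightCrossings_self (A : Finset α) : (rightCrossings A A).card = 0 := by
  rw [Finset.card_eq_zero, Finset.eq_empty_iff_forall_notMem]
  rintro ⟨⟨a, b⟩, ⟨c, d⟩⟩ h
  simp only [rightCrossings, Finset.mem_filter, Finset.mem_product, mem_blockChords] at h
  obtain ⟨⟨⟨-, -, h⟩, ⟨hc, hd⟩, -⟩, h1, h2, h3⟩ := h
  rcases h with h | h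
  · exact h _ hc ⟨h1, h2⟩
  · exact (h.2 _ hd).2.not_gt h3

lemma card_rightCrossings_add_le (A B : Finset α) :
    (rightCrossings A B).card + (rightCrossings B A).card ≤ (crossings A B).card := by
  classical
  rw [← Finset.card_image_of_injective (rightCrossings B A) Prod.swap_injective,
    ← Finset.card_union_of_disjoint]
  · refine Finset.card_le_card fun q hq => ?_
    simp only [Finset.mem_union, Finset.mem_image, rightCrossings, crossings, Finset.mem_filter,
      Finset.mem_product] at hq ⊢
    rcases hq with hq | ⟨p, hp, rfl⟩
    · exact ⟨hq.1, Or.inl hq.2⟩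
    · exact ⟨hp.1.symm, Or.inr hp.2⟩
  · rw [Finset.disjoint_left]
    intro q hq hq'
    simp only [Finset.mem_image, rightCrossings, Finset.mem_filter] at hq hq'
    obtain ⟨p, hp, rfl⟩ := hq'
    exact lt_asymm hq.2.1 hp.2.1

lemma card_crossings_comm (A B : Finset α) : (crossings A B).card = (crossings B A).card := by
  refine Finset.card_nbij' Prod.swap Prod.swap ?_ ?_ ?_ ?_ <;> intro q hq <;>
    simp_all [crossings, or_comm]

lemma card_crossings_le (A B : Finset α) :
    (crossings A B).card ≤ 2 * (blockChords B).card := by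
  classical
  refine Finset.card_le_mul_card_image_of_maps_to (f := Prod.snd) (t := blockChords B) ?_ 2 ?_
  · intro q hq
    simp only [crossings, Finset.mem_filter, Finset.mem_product] at hq
    exact hq.1.2
  · rintro ⟨c, d⟩ -
    refine le_trans (Finset.card_le_card_of_injOn Prod.fst ?_ ?_) (card_crossing_le_two A c d)
    · rintro ⟨e, e'⟩ hq
      simp only [crossings, Finset.mem_filter, Finset.mem_product, Finset.coe_filter,
        Set.mem_ofPred_eq] at hq ⊢
      obtain ⟨⟨⟨h1, h2⟩, h3⟩, rfl⟩ := hq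
      exact ⟨h1, h3⟩
    · intro q hq q' hq' heq
      simp only [Finset.coe_filter, Set.mem_ofPred_eq] at hq hq'
      exact Prod.ext heq (hq.2.trans hq'.2.symm)

lemma card_crossings_le_mul (A B : Finset α) :
    (crossings A B).card ≤ (blockChords A).card * (blockChords B).card := by
  rw [← Finset.card_product]
  exact Finset.card_filter_le _ _

lemma card_crossings_le_two_mul_min (A B : Finset α) :
    (crossings A B).card ≤ 2 * min A.card B.card := by
  have h1 := card_crossings_le A B
  have h2 := card_crossings_le B A
  rw [card_crossings_comm] at h2
  have h3 := card_blockChords_le A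
  have h4 := card_blockChords_le B
  omega

/-- Crossing bound by block sizes that distinguishes blocks of size one and two. -/
lemma card_crossings_le_ite (A B : Finset α) :
    (crossings A B).card ≤
      (if 3 ≤ A.card then A.card else 0) * (if 3 ≤ B.card then 1 else 0) +
      (if 3 ≤ A.card then 1 else 0) * (if 3 ≤ B.card then B.card else 0) +
      2 * ((if 3 ≤ A.card then 1 else 0) * (if B.card = 2 then 1 else 0)) +
      2 * ((if A.card = 2 then 1 else 0) * (if 3 ≤ B.card then 1 else 0)) +
      (if A.card = 2 then 1 else 0) * (if B.card = 2 then 1 else 0) := by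
  have h1 := card_crossings_le A B
  have h2 := card_crossings_le B A
  rw [card_crossings_comm] at h2
  have h3 := card_blockChords_le A
  have h4 := card_blockChords_le B
  rcases Nat.lt_or_ge A.card 2 with hA | hA
  · have := card_blockChords_eq_zero (B := A) (by omega)
    omega
  rcases Nat.lt_or_ge B.card 2 with hB | hB
  · have := card_blockChords_eq_zero (B := B) (by omega)
    omega
  rcases Nat.eq_or_lt_of_le hA with hA | hA <;> rcases Nat.eq_or_lt_of_le hB with hB | hB
  · have h5 := card_blockChords_le_one (B := A) hA.ge
    have h6 := card_blockChords_le_one (B := B) hB.ge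
    have := (card_crossings_le_mul A B).trans (Nat.mul_le_mul h5 h6)
    simpa [← hA, ← hB] using this
  · have h5 := card_blockChords_le_one (B := A) hA.ge
    have hB' : 3 ≤ B.card := hB
    have hB2 : B.card ≠ 2 := by omega
    simp [← hA, hB', hB2]
    omega
  · have h6 := card_blockChords_le_one (B := B) hB.ge
    have hA' : 3 ≤ A.card := hA
    have hA2 : A.card ≠ 2 := by omega
    simp [← hB, hA', hA2]
    omega
  · have hA' : 3 ≤ A.card := hA
    have hB' : 3 ≤ B.card := hB
    simp [hA', hB']
    omega

end Blocks

lemma crc_le_sum {n : ℕ} (π : Finpartition (univ : Finset (Fin n))) :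
    crc π ≤ ∑ A ∈ π.parts, ∑ B ∈ π.parts, (rightCrossings A B).card := by
  have hsub : {q : (Fin n × Fin n) × (Fin n × Fin n) |
      IsChord π q.1.1 q.1.2 ∧ IsChord π q.2.1 q.2.2 ∧
      q.1.1 < q.2.1 ∧ q.2.1 < q.1.2 ∧ q.1.2 < q.2.2} ⊆
      ((π.parts ×ˢ π.parts).biUnion fun P => rightCrossings P.1 P.2 :
        Finset ((Fin n × Fin n) × (Fin n × Fin n))) := by
    rintro ⟨⟨a, b⟩, ⟨c, d⟩⟩ ⟨⟨hab, A, hA, h1⟩, ⟨hcd, B, hB, h2⟩, h3⟩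
    simp only [Finset.coe_biUnion, Set.mem_iUnion, Finset.mem_coe, Finset.mem_product]
    refine ⟨(A, B), ⟨hA, hB⟩, ?_⟩
    simp only [rightCrossings, Finset.mem_filter, Finset.mem_product, mem_blockChords]
    exact ⟨⟨⟨⟨h1.1, h1.2.1⟩, hab, h1.2.2⟩, ⟨h2.1, h2.2.1⟩, hcd, h2.2.2⟩, h3⟩
  rw [← Finset.sum_product (f := fun P : Finset (Fin n) × Finset (Fin n) =>
    (rightCrossings P.1 P.2).card)]
  refine (Set.ncard_le_ncard hsub (Finset.finite_toSet _)).trans ?_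
  rw [Set.ncard_coe_finset]
  exact Finset.card_biUnion_le

/-- Twice the crossing number is bounded by any pairwise bound on crossings of distinct blocks,
summed over ordered pairs of distinct blocks. -/
lemma two_mul_crc_add_le {n : ℕ} (π : Finpartition (univ : Finset (Fin n)))
    (F : Finset (Fin n) → Finset (Fin n) → ℕ)
    (hF : ∀ A B : Finset (Fin n), (crossings A B).card ≤ F A B) :
    2 * crc π + ∑ A ∈ π.parts, F A A ≤ ∑ A ∈ π.parts, ∑ B ∈ π.parts, F A B := by
  have h1 := crc_le_sum π
  have h2 := h1
  rw [Finset.sum_comm] at h2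
  have h3 : ∑ A ∈ π.parts, ∑ B ∈ π.parts, (if A = B then F A A else 0) =
      ∑ A ∈ π.parts, F A A :=
    Finset.sum_congr rfl fun A hA => by simp [hA]
  rw [two_mul, ← h3]
  refine (Nat.add_le_add_right (Nat.add_le_add h1 h2) _).trans ?_
  simp only [← Finset.sum_add_distrib]
  refine Finset.sum_le_sum fun A hA => Finset.sum_le_sum fun B hB => ?_
  split_ifs with hAB
  · subst hAB
    simp [card_rightCrossings_self]
  · exact (card_rightCrossings_add_le A B).trans (hF A B)

lemma sum_sub_ge {ι : Type*} (S : Finset ι) (m : ι → ℤ) (q r : ℤ) (hr : 0 ≤ r)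
    (hrk : r ≤ S.card) (hsum : ∑ i ∈ S, m i = S.card * q + r) :
    r * (S.card - r) ≤ ∑ i ∈ S, ∑ j ∈ S, max (m i - m j) 0 := by
  classical
  set L := S.filter fun i => q + 1 ≤ m i with hL
  set M := S.filter fun i => ¬ q + 1 ≤ m i with hM
  have hcard : (L.card : ℤ) + M.card = S.card := by
    exact_mod_cast Finset.card_filter_add_card_filter_not (s := S) (fun i => q + 1 ≤ m i)
  have hs : ∑ i ∈ L, m i + ∑ i ∈ M, m i = S.card * q + r := by
    rw [← hsum]; exact Finset.sum_filter_add_sum_filter_not S _ _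
  have hP : (L.card : ℤ) * (q + 1) ≤ ∑ i ∈ L, m i := by
    simpa using Finset.card_nsmul_le_sum L m (q + 1) fun i hi => (Finset.mem_filter.1 hi).2
  have hQ : ∑ i ∈ M, m i ≤ M.card * q := by
    simpa using Finset.sum_le_card_nsmul M m q fun i hi => by
      have := (Finset.mem_filter.1 hi).2
      omega
  have hle : ∑ i ∈ L, ∑ j ∈ M, (m i - m j) ≤ ∑ i ∈ S, ∑ j ∈ S, max (m i - m j) 0 := by
    refine (Finset.sum_le_sum fun i _ => (?_ : _ ≤ ∑ j ∈ S, max (m i - m j) 0)).trans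
      (Finset.sum_le_sum_of_subset_of_nonneg (Finset.filter_subset _ _) fun i _ _ =>
        Finset.sum_nonneg fun j _ => le_max_right _ _)
    exact (Finset.sum_le_sum fun j _ => le_max_left _ _).trans
      (Finset.sum_le_sum_of_subset_of_nonneg (Finset.filter_subset _ _) fun j _ _ =>
        le_max_right _ _)
  refine le_trans ?_ hle
  simp only [Finset.sum_sub_distrib, Finset.sum_const, nsmul_eq_mul, ← Finset.mul_sum]
  generalize ∑ i ∈ L, m i = P at *
  generalize ∑ i ∈ M, m i = Q at *
  have hl : (0 : ℤ) ≤ L.card := by positivity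
  have hm : (0 : ℤ) ≤ M.card := by positivity
  generalize (L.card : ℤ) = l at *
  generalize (M.card : ℤ) = t at *
  rw [← hcard] at hs hrk ⊢
  obtain rfl : Q = (l + t) * q + r - P := by linarith
  rcases le_total l r with h | h
  · nlinarith [mul_nonneg (add_nonneg hl hm) (sub_nonneg.2 hQ), mul_nonneg hr (sub_nonneg.2 h)]
  · nlinarith [mul_nonneg (add_nonneg hl hm) (sub_nonneg.2 hP),
      mul_nonneg (sub_nonneg.2 hrk) (sub_nonneg.2 h)]

lemma crc_le_balanced {n : ℕ} (π : Finpartition (univ : Finset (Fin n))) (hk : 1 ≤ π.parts.card) :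
    crc π ≤ (π.parts.card - 1) * n - (n % π.parts.card) * (π.parts.card - n % π.parts.card) := by
  set k := π.parts.card with hkdef
  have h := two_mul_crc_add_le π (fun A B => 2 * min A.card B.card)
    card_crossings_le_two_mul_min
  have hsum : ∑ A ∈ π.parts, A.card = n := by simpa using π.sum_card_parts
  have hr : n % k < k := Nat.mod_lt _ hk
  have h2 := sum_sub_ge π.parts (fun A => (A.card : ℤ)) (n / k : ℕ) (n % k : ℕ) (by positivity)
    (by exact_mod_cast hr.le) (by
      rw [← Nat.cast_sum, hsum]
      exact_mod_cast (Nat.div_add_mod n k).symm)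
  have h3 : ∑ A ∈ π.parts, ∑ B ∈ π.parts, (min A.card B.card : ℤ) +
      ∑ A ∈ π.parts, ∑ B ∈ π.parts, max ((A.card : ℤ) - B.card) 0 = k * n := by
    have hsum' : (n : ℤ) = ∑ A ∈ π.parts, (A.card : ℤ) := by exact_mod_cast hsum.symm
    rw [← Finset.sum_add_distrib, hsum', Finset.mul_sum]
    refine Finset.sum_congr rfl fun A _ => ?_
    rw [← Finset.sum_add_distrib, hkdef, ← nsmul_eq_mul, ← Finset.sum_const]
    refine Finset.sum_congr rfl fun B _ => ?_
    omega
  simp only [min_self, ← Finset.mul_sum, hsum] at h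
  zify at h
  rw [← hkdef] at h2
  apply Nat.le_sub_of_add_le
  zify [hk, hr.le]
  push_cast at h2
  linarith

lemma crc_le_small_blocks {n : ℕ} (π : Finpartition (univ : Finset (Fin n))) :
    ∃ x y b : ℕ, 2 * x ≤ b ∧ x + y ≤ π.parts.card ∧ n = b + y + π.parts.card ∧
      2 * (crc π : ℤ) ≤ 2 * (x - 1) * (b + x) + 4 * x * y + y * (y - 1) := by
  have h := two_mul_crc_add_le π _ card_crossings_le_ite
  have hsum : ∑ A ∈ π.parts, A.card = n := by simpa using π.sum_card_parts
  have hpos : ∀ A ∈ π.parts, 1 ≤ A.card := fun A hA =>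
    Finset.card_pos.2 (π.nonempty_of_mem_parts hA)
  obtain ⟨x, hx⟩ : ∃ x, ∑ A ∈ π.parts, (if 3 ≤ A.card then 1 else 0) = x := ⟨_, rfl⟩
  obtain ⟨y, hy⟩ : ∃ y, ∑ A ∈ π.parts, (if A.card = 2 then 1 else 0) = y := ⟨_, rfl⟩
  obtain ⟨u, hu⟩ : ∃ u, ∑ A ∈ π.parts, (if 3 ≤ A.card then A.card else 0) = u := ⟨_, rfl⟩
  have hxu : 3 * x ≤ u := by
    rw [← hx, ← hu, Finset.mul_sum]
    refine Finset.sum_le_sum fun A _ => ?_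
    split_ifs <;> omega
  have hxy : x + y ≤ π.parts.card := by
    rw [← hx, ← hy, ← Finset.sum_add_distrib, Finset.card_eq_sum_ones]
    refine Finset.sum_le_sum fun A _ => ?_
    split_ifs <;> omega
  have hn : n + x = u + y + π.parts.card := by
    refine (congrArg (· + x) hsum.symm).trans ?_
    rw [← hx, ← hy, ← hu, Finset.card_eq_sum_ones, ← Finset.sum_add_distrib,
      ← Finset.sum_add_distrib, ← Finset.sum_add_distrib]
    refine Finset.sum_congr rfl fun A hA => ?_
    have := hpos A hA
    split_ifs <;> omega
  have hdiag : 2 * u + y = ∑ A ∈ π.parts,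
      ((if 3 ≤ A.card then A.card else 0) * (if 3 ≤ A.card then 1 else 0) +
      (if 3 ≤ A.card then 1 else 0) * (if 3 ≤ A.card then A.card else 0) +
      2 * ((if 3 ≤ A.card then 1 else 0) * (if A.card = 2 then 1 else 0)) +
      2 * ((if A.card = 2 then 1 else 0) * (if 3 ≤ A.card then 1 else 0)) +
      (if A.card = 2 then 1 else 0) * (if A.card = 2 then 1 else 0)) := by
    rw [← hu, ← hy, Finset.mul_sum, ← Finset.sum_add_distrib]
    refine Finset.sum_congr rfl fun A _ => ?_
    split_ifs <;> omega
  rw [← hdiag] at h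
  simp only [Finset.sum_add_distrib, ← Finset.mul_sum, ← Finset.sum_mul, hx, hy, hu] at h
  refine ⟨x, y, u - x, by omega, hxy, by omega, ?_⟩
  zify at h
  rw [Nat.cast_sub (by omega)]
  linarith

lemma choose_two_cast (m : ℕ) : 2 * (m.choose 2 : ℤ) = m * (m - 1) := by
  rcases m with - | m
  · simp
  have : (m + 1).choose 2 * 2 = (m + 1) * m := by
    rw [Nat.choose_two_right, Nat.add_sub_cancel]
    exact Nat.div_mul_cancel (by simpa [mul_comm] using (Nat.even_mul_succ_self m).two_dvd)
  push_cast
  zify at this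
  linarith

/-- Blocks of size three maximize the bound of `crc_le_small_blocks` when `b + y ≥ 4`. -/
lemma small_blocks_bound_triples {x y b : ℕ} (hx : 2 * x ≤ b) (ha : 4 ≤ b + y) :
    2 * ((x : ℤ) - 1) * (b + x) + 4 * x * y + y * (y - 1) ≤
      2 * (6 * (((b + y) / 2).choose 2 : ℤ) +
        if (b + y) % 2 = 1 then 2 * (((b + y) / 2 : ℕ) : ℤ) else 0) := by
  obtain ⟨c, e, he, rfl⟩ : ∃ c e, e < 2 ∧ b = 2 * c + e :=
    ⟨b / 2, b % 2, by omega, by omega⟩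
  obtain ⟨t, o, ho, hto⟩ : ∃ t o, o < 2 ∧ 2 * c + e + y = 2 * t + o :=
    ⟨(2 * c + e + y) / 2, (2 * c + e + y) % 2, by omega, by omega⟩
  have h1 : (2 * c + e + y) / 2 = t := by omega
  have h2 : (2 * c + e + y) % 2 = o := by omega
  have h3 := choose_two_cast t
  rw [h1, h2]
  have hxc : x ≤ c := by omega
  have hct : c ≤ t := by omega
  have ht : 2 ≤ t := by omega
  obtain ⟨d, rfl⟩ := Nat.exists_eq_add_of_le hct
  have hmono : 2 * ((x : ℤ) - 1) * ((2 * c + e : ℕ) + x) + 4 * x * y ≤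
      2 * ((c : ℤ) - 1) * ((2 * c + e : ℕ) + c) + 4 * c * y := by
    obtain ⟨f, rfl⟩ := Nat.exists_eq_add_of_le hxc
    rcases Nat.eq_zero_or_pos f with rfl | hf
    · simp
    · push_cast
      have hf' : (1 : ℤ) ≤ f := by exact_mod_cast hf
      have : (0 : ℤ) ≤ f * ((x + f) + x + (2 * (x + f) + e - 1) + 2 * y) := by
        apply mul_nonneg <;> linarith
      linarith
  have hy : (y : ℤ) = 2 * d + o - e := by omega
  have hd : (0 : ℤ) ≤ d * (2 * c + d - 2) := by
    rcases Nat.eq_zero_or_pos d with rfl | hd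
    · simp
    · apply mul_nonneg <;> omega
  refine (add_le_add_left hmono _).trans ?_
  rw [hy]
  have hcd : (0 : ℤ) ≤ c * d := by positivity
  have hdd : (0 : ℤ) ≤ d * d := by positivity
  push_cast at h3 ⊢
  interval_cases e <;> interval_cases o <;> norm_num <;> linarith

lemma small_blocks_bound_triples_of_lt {x y b k : ℕ} (hx : 2 * x ≤ b) (hxy : x + y ≤ k)
    (hk : k < b + y) (hk' : b + y ≤ 2 * k) (ha : b + y < 4) :
    2 * ((x : ℤ) - 1) * (b + x) + 4 * x * y + y * (y - 1) ≤
      2 * (6 * (((b + y) / 2).choose 2 : ℤ) +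
        if (b + y) % 2 = 1 then 2 * (((b + y) / 2 : ℕ) : ℤ) else 0) := by
  have : b ≤ 3 := by omega
  have : y ≤ 3 := by omega
  have : x ≤ 1 := by omega
  interval_cases b <;> interval_cases y <;> interval_cases x <;> omega

lemma small_blocks_bound_pairs {x y b : ℕ} (hx : 2 * x ≤ b) (ha : b + y ≤ 5) :
    2 * ((x : ℤ) - 1) * (b + x) + 4 * x * y + y * (y - 1) ≤ 2 * ((b + y).choose 2 : ℤ) := by
  rw [choose_two_cast]
  have : x ≤ 2 := by omega
  have : b ≤ 5 := by omega
  have : y ≤ 5 := by omega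
  interval_cases x <;> interval_cases b <;> interval_cases y <;> simp_all

/-- The label of `i` in the partition with blocks the residue classes modulo `s` of `{0, …, N - 1}`
and singletons elsewhere. -/
def cyclicLabel (s N i : ℕ) : ℕ := if i < N then i % s else s + (i - N)

/-- The partition of `[n]` into the residue classes modulo `s` of `{0, …, N - 1}`
and singletons. -/
def cyclicPartition (n s N : ℕ) : Finpartition (univ : Finset (Fin n)) :=
  let S : Setoid (Fin n) := Setoid.ker fun i => cyclicLabel s N i
  have : DecidableRel S.r := fun a b =>
    inferInstanceAs (Decidable (cyclicLabel s N a = cyclicLabel s N b))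
  Finpartition.ofSetoid S

lemma cyclicPartition_parts (n s N : ℕ) : (cyclicPartition n s N).parts =
    univ.image fun a : Fin n =>
      ({b : Fin n | cyclicLabel s N a = cyclicLabel s N b} : Finset (Fin n)) := rfl

lemma card_cyclicPartition_parts {n s N : ℕ} (hs : s ≤ N) (hs' : N = 0 ∨ 0 < s) (hN : N ≤ n) :
    (cyclicPartition n s N).parts.card = s + (n - N) := by
  rw [cyclicPartition_parts, ← Finset.card_range (s + (n - N))]
  have himg : (univ.image fun a : Fin n => cyclicLabel s N a) = Finset.range (s + (n - N)) := by
    ext v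
    simp only [Finset.mem_image, Finset.mem_univ, true_and, Finset.mem_range, cyclicLabel]
    constructor
    · rintro ⟨a, rfl⟩
      split_ifs with h
      · exact (Nat.mod_lt _ (by omega)).trans_le (Nat.le_add_right _ _)
      · omega
    · intro hv
      rcases Nat.lt_or_ge v s with h | h
      · exact ⟨⟨v, by omega⟩, by simp [Nat.mod_eq_of_lt h, h.trans_le hs]⟩
      · exact ⟨⟨v - s + N, by omega⟩, by simp; omega⟩
  rw [← himg]
  have : (univ.image fun a : Fin n =>
      ({b : Fin n | cyclicLabel s N a = cyclicLabel s N b} : Finset (Fin n))) =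
      (univ.image fun a : Fin n => cyclicLabel s N a).image
        fun v => ({b : Fin n | v = cyclicLabel s N b} : Finset (Fin n)) := by
    rw [Finset.image_image]; rfl
  rw [this]
  refine Finset.card_image_of_injOn ?_
  intro v hv w hw h
  obtain ⟨a, -, rfl⟩ := Finset.mem_image.1 hv
  have : a ∈ ({b : Fin n | cyclicLabel s N a = cyclicLabel s N b} : Finset (Fin n)) := by simp
  simp only at h
  rw [h] at this
  exact (Finset.mem_filter.1 this).2.symm

/-- A sufficient arithmetic condition for a chord of `cyclicPartition n s N`. -/
def CyclicChord (s N a b : ℕ) : Prop :=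
  (b = a + s ∧ b < N) ∨ (a < s ∧ b % s = a ∧ N ≤ b + s ∧ b < N ∧ a + 2 * s ≤ b)

lemma isChord_cyclicPartition {n s N : ℕ} (hs : 0 < s) {a b : Fin n}
    (h : CyclicChord s N a b) : IsChord (cyclicPartition n s N) a b := by
  have hlab : cyclicLabel s N a = cyclicLabel s N b := by
    rcases h with ⟨h1, h2⟩ | ⟨h1, h2, h3, h4, h5⟩
    · rw [cyclicLabel, cyclicLabel, if_pos (by omega), if_pos h2, h1, Nat.add_mod_right]
    · rw [cyclicLabel, cyclicLabel, if_pos (by omega), if_pos h4, h2, Nat.mod_eq_of_lt h1]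
  have hab : a < b := by
    rw [Fin.lt_def]
    rcases h with h | h <;> omega
  have hbN : (b : ℕ) < N := by rcases h with h | h <;> omega
  have hmod : ∀ c : Fin n, cyclicLabel s N a = cyclicLabel s N c →
      (c : ℕ) < N ∧ (a : ℕ) % s = c % s := by
    intro c hc
    have := Nat.mod_lt a hs
    rw [cyclicLabel, if_pos (by omega), cyclicLabel] at hc
    split_ifs at hc <;> omega
  have hgap : ∀ c d : ℕ, c % s = d % s → c < d → c + s ≤ d := by
    intro c d h1 h2
    have := Nat.le_of_dvd (by omega) ((Nat.modEq_iff_dvd' h2.le).1 h1)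
    omega
  refine ⟨hab, ({c : Fin n | cyclicLabel s N a = cyclicLabel s N c} : Finset (Fin n)), ?_,
    by simp, by simpa, ?_⟩
  · rw [cyclicPartition_parts]
    exact Finset.mem_image_of_mem _ (Finset.mem_univ a)
  rcases h with ⟨h1, h2⟩ | ⟨h1, h2, h3, h4, h5⟩
  · left
    intro c hc ⟨hac, hcb⟩
    have h3 := hmod c (by simpa using hc)
    have := hgap a c h3.2 hac
    rw [Fin.lt_def] at hcb
    omega
  · right
    refine ⟨?_, fun c hc => ?_⟩
    · have hm : (a : ℕ) + s < n := by omega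
      have hsub : ({a, ⟨a + s, hm⟩, b} : Finset (Fin n)) ⊆
          ({c : Fin n | cyclicLabel s N a = cyclicLabel s N c} : Finset (Fin n)) := by
        simp only [Finset.insert_subset_iff, Finset.mem_filter, Finset.mem_univ, true_and,
          Finset.singleton_subset_iff]
        refine ⟨?_, hlab⟩
        rw [cyclicLabel, cyclicLabel, if_pos (by omega), if_pos (by omega)]
        simp
      refine le_trans ?_ (Finset.card_le_card hsub)
      rw [Finset.card_insert_of_notMem, Finset.card_pair]
      · rw [Ne, Fin.ext_iff]; simp; omega
      · simp only [Finset.mem_insert, Finset.mem_singleton, Fin.ext_iff]; omega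
    · have h6 := hmod c (by simpa using hc)
      rw [Fin.le_def, Fin.le_def]
      constructor
      · rw [Nat.mod_eq_of_lt h1] at h6
        rw [h6.2]
        exact Nat.mod_le _ _
      · by_contra! hlt
        have := hgap b c (by rw [← h6.2, h2, Nat.mod_eq_of_lt h1]) hlt
        omega

lemma card_le_crc_cyclicPartition {n s N : ℕ} (hs : 0 < s) (hN : N ≤ n)
    (T : Finset ((ℕ × ℕ) × (ℕ × ℕ)))
    (hT : ∀ q ∈ T, CyclicChord s N q.1.1 q.1.2 ∧ CyclicChord s N q.2.1 q.2.2 ∧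
      CrossesRight q.1 q.2) : T.card ≤ crc (cyclicPartition n s N) := by
  let v : Fin n × Fin n → ℕ × ℕ := Prod.map Fin.val Fin.val
  have hv : Function.Injective v := Fin.val_injective.prodMap Fin.val_injective
  rw [crc, ← Set.ncard_image_of_injective _ (hv.prodMap hv),
    ← Set.ncard_coe_finset]
  refine Set.ncard_le_ncard ?_ (Set.toFinite _)
  rintro ⟨⟨a, b⟩, ⟨c, d⟩⟩ hq
  obtain ⟨h1, h2, h3⟩ := hT _ hq
  have hd : d < N := by rcases h2 with h | h <;> simp only at h <;> omega
  simp only [CrossesRight] at h1 h2 h3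
  exact ⟨((⟨a, by omega⟩, ⟨b, by omega⟩), (⟨c, by omega⟩, ⟨d, by omega⟩)),
    ⟨isChord_cyclicPartition hs h1, isChord_cyclicPartition hs h2, h3⟩, rfl⟩

/-- The pairs `i < j < m`. -/
def ltPairs (m : ℕ) : Finset (ℕ × ℕ) := {p ∈ Finset.range m ×ˢ Finset.range m | p.1 < p.2}

lemma mem_ltPairs {m : ℕ} {p : ℕ × ℕ} : p ∈ ltPairs m ↔ p.1 < p.2 ∧ p.2 < m := by
  simp only [ltPairs, Finset.mem_filter, Finset.mem_product, Finset.mem_range]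
  omega

lemma card_ltPairs (m : ℕ) : (ltPairs m).card = m.choose 2 := by
  induction m with
  | zero => simp [ltPairs]
  | succ m ih =>
    have : ltPairs (m + 1) = ltPairs m ∪ (Finset.range m).image fun i => (i, m) := by
      ext ⟨i, j⟩
      simp only [mem_ltPairs, Finset.mem_union, Finset.mem_image, Finset.mem_range, Prod.mk.injEq]
      constructor
      · intro h
        rcases Nat.lt_or_ge j m with hj | hj
        · exact Or.inl ⟨h.1, hj⟩
        · exact Or.inr ⟨i, by omega, rfl, by omega⟩
      · rintro (h | ⟨a, ha, rfl, rfl⟩) <;> omega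
    rw [this, Finset.card_union_of_disjoint, ih, Finset.card_image_of_injective,
      Finset.card_range, Nat.choose_succ_succ' m 1, Nat.choose_one_right, add_comm]
    · intro i j h
      simpa using h
    · rw [Finset.disjoint_left]
      rintro ⟨i, j⟩ h h'
      rw [mem_ltPairs] at h
      simp only [Finset.mem_image, Prod.mk.injEq] at h'
      obtain ⟨a, -, -, rfl⟩ := h'
      exact h.2.false

/-- Crossings of `cyclicPartition n s N`, where `L p` is the last element congruent to `p` for
`p < t`, and `D` consists of pairs of residues whose closing chords cross. -/
lemma le_crc_cyclicPartition {n s N t : ℕ} (hs : 0 < s) (hN : N ≤ n) (hts : t ≤ s)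
    (htN : 2 * s + t ≤ N) (L : ℕ → ℕ)
    (hL : ∀ p < t, L p % s = p ∧ N ≤ L p + s ∧ L p < N ∧ p + 2 * s ≤ L p)
    (D : Finset (ℕ × ℕ)) (hD : ∀ p ∈ D, p.1 < p.2 ∧ p.2 < t ∧ L p.1 < L p.2) :
    s.choose 2 + (N - 2 * s) * (s - 1) + 2 * t.choose 2 + D.card ≤
      crc (cyclicPartition n s N) := by
  let fA : ℕ × ℕ → (ℕ × ℕ) × (ℕ × ℕ) := fun p => ((p.1, p.1 + s), (p.2, p.2 + s))
  let fA' : ℕ × ℕ → (ℕ × ℕ) × (ℕ × ℕ) :=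
    fun p => ((p.1 + 1 + p.2, p.1 + 1 + p.2 + s), (p.1 + s, p.1 + 2 * s))
  let fB : ℕ × ℕ → (ℕ × ℕ) × (ℕ × ℕ) := fun p => ((p.1, p.1 + s), (p.2, L p.2))
  let fC : ℕ × ℕ → (ℕ × ℕ) × (ℕ × ℕ) := fun p =>
    (((N - t + p.1) % s, N - t + p.1), (N - t + p.2 - s, N - t + p.2))
  let fD : ℕ × ℕ → (ℕ × ℕ) × (ℕ × ℕ) := fun p => ((p.1, L p.1), (p.2, L p.2))
  let P' := Finset.range (N - 2 * s) ×ˢ Finset.range (s - 1)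
  have iA : fA.Injective := by
    rintro ⟨a, b⟩ ⟨c, d⟩ h; simp only [fA, Prod.mk.injEq] at h ⊢; omega
  have iA' : fA'.Injective := by
    rintro ⟨a, b⟩ ⟨c, d⟩ h; simp only [fA', Prod.mk.injEq] at h ⊢; omega
  have iB : fB.Injective := by
    rintro ⟨a, b⟩ ⟨c, d⟩ h; simp only [fB, Prod.mk.injEq] at h ⊢; omega
  have iC : fC.Injective := by
    rintro ⟨a, b⟩ ⟨c, d⟩ h; simp only [fC, Prod.mk.injEq] at h ⊢; omega
  have iD : fD.Injective := by
    rintro ⟨a, b⟩ ⟨c, d⟩ h; simp only [fD, Prod.mk.injEq] at h ⊢; omega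
  have hmod : ∀ x, x % s < s := fun x => Nat.mod_lt x hs
  have hclose : ∀ x, 2 * s ≤ x → x % s + 2 * s ≤ x := by
    intro x hx
    have h1 := Nat.div_add_mod x s
    have h2 : 2 ≤ x / s := (Nat.le_div_iff_mul_le hs).2 hx
    have h3 := Nat.mul_le_mul_left s h2
    omega
  have hT := card_le_crc_cyclicPartition hs hN ((((((ltPairs s).image fA) ∪ P'.image fA') ∪
      (ltPairs t).image fB) ∪ (ltPairs t).image fC) ∪ D.image fD) ?_
  · rw [Finset.card_union_of_disjoint, Finset.card_union_of_disjoint,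
      Finset.card_union_of_disjoint, Finset.card_union_of_disjoint,
      Finset.card_image_of_injective _ iA, Finset.card_image_of_injective _ iA',
      Finset.card_image_of_injective _ iB, Finset.card_image_of_injective _ iC,
      Finset.card_image_of_injective _ iD, card_ltPairs, card_ltPairs, Finset.card_product,
      Finset.card_range, Finset.card_range] at hT
    · omega
    all_goals
      rw [Finset.disjoint_left]
      intro x hx hx'
      obtain ⟨p, hp, rfl⟩ := Finset.mem_image.1 hx'
      simp only [Finset.mem_union, Finset.mem_image] at hx
    · obtain ⟨p', hp', h⟩ := hx
      rw [mem_ltPairs] at hp'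
      simp only [fA, fA', Prod.mk.injEq] at h
      omega
    · rw [mem_ltPairs] at hp
      have := hL p.2 hp.2
      rcases hx with ⟨p', hp', h⟩ | ⟨p', hp', h⟩ <;>
        simp only [fA, fA', fB, Prod.mk.injEq] at h <;> omega
    · rw [mem_ltPairs] at hp
      have := hclose (N - t + p.1) (by omega)
      rcases hx with (⟨p', hp', h⟩ | ⟨p', hp', h⟩) | ⟨p', hp', h⟩ <;>
        simp only [fA, fA', fB, fC, Prod.mk.injEq] at h <;> omega
    · have hp := hD p hp
      have h1 := hL p.1 (by omega)
      have h2 := hL p.2 (by omega)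
      rcases hx with ((⟨p', hp', h⟩ | ⟨p', hp', h⟩) | ⟨p', hp', h⟩) | ⟨p', hp', h⟩ <;>
        simp only [fA, fA', fB, fC, fD, Prod.mk.injEq] at h <;> omega
  · intro x hx
    simp only [Finset.mem_union, Finset.mem_image] at hx
    simp only [CyclicChord, CrossesRight]
    rcases hx with (((⟨p, hp, rfl⟩ | ⟨p, hp, rfl⟩) | ⟨p, hp, rfl⟩) | ⟨p, hp, rfl⟩) | ⟨p, hp, rfl⟩
    · rw [mem_ltPairs] at hp
      dsimp only [fA]
      exact ⟨Or.inl ⟨rfl, by omega⟩, Or.inl ⟨rfl, by omega⟩, by omega, by omega, by omega⟩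
    · simp only [P', Finset.mem_product, Finset.mem_range] at hp
      dsimp only [fA']
      exact ⟨Or.inl ⟨rfl, by omega⟩, Or.inl ⟨by omega, by omega⟩, by omega, by omega, by omega⟩
    · rw [mem_ltPairs] at hp
      obtain ⟨h1, h2, h3, h4⟩ := hL p.2 hp.2
      dsimp only [fB]
      exact ⟨Or.inl ⟨rfl, by omega⟩, Or.inr ⟨by omega, h1, h2, h3, h4⟩, by omega, by omega,
        by omega⟩
    · rw [mem_ltPairs] at hp
      have h1 := hclose (N - t + p.1) (by omega)
      have h2 := hmod (N - t + p.1)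
      dsimp only [fC]
      exact ⟨Or.inr ⟨h2, rfl, by omega, by omega, h1⟩, Or.inl ⟨by omega, by omega⟩, by omega,
        by omega, by omega⟩
    · have hp := hD p hp
      obtain ⟨h1, h2, h3, h4⟩ := hL p.1 (by omega)
      obtain ⟨h1', h2', h3', h4'⟩ := hL p.2 (by omega)
      dsimp only [fD]
      exact ⟨Or.inr ⟨by omega, h1, h2, h3, h4⟩, Or.inr ⟨by omega, h1', h2', h3', h4'⟩, hp.1,
        by omega, hp.2.2⟩

lemma le_crc_cyclicPartition_balanced {n s : ℕ} (hs : 0 < s) (hn : 3 * s ≤ n) :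
    2 * s.choose 2 * (n / s) + 2 * (n % s).choose 2 ≤ crc (cyclicPartition n s n) := by
  obtain ⟨q, r, hr, hq, rfl⟩ : ∃ q r, r < s ∧ 3 ≤ q ∧ n = s * q + r :=
    ⟨n / s, n % s, Nat.mod_lt _ hs, (Nat.le_div_iff_mul_le hs).2 hn, (Nat.div_add_mod n s).symm⟩
  obtain ⟨q, rfl⟩ := Nat.exists_eq_add_of_le hq
  have hdiv : (s * (3 + q) + r) / s = 3 + q := by
    rw [Nat.mul_add_div hs, Nat.div_eq_of_lt hr, add_zero]
  have hmod : (s * (3 + q) + r) % s = r := by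
    rw [Nat.mul_add_mod, Nat.mod_eq_of_lt hr]
  rw [hdiv, hmod]
  let D := ltPairs r ∪ (ltPairs (s - r)).image fun p => (r + p.1, r + p.2)
  have hDcard : D.card = r.choose 2 + (s - r).choose 2 := by
    rw [Finset.card_union_of_disjoint, Finset.card_image_of_injective, card_ltPairs, card_ltPairs]
    · rintro ⟨a, b⟩ ⟨c, d⟩ h
      simp only [Prod.mk.injEq] at h ⊢
      omega
    · rw [Finset.disjoint_left]
      intro p hp hp'
      rw [mem_ltPairs] at hp
      obtain ⟨p', -, rfl⟩ := Finset.mem_image.1 hp'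
      simp only at hp
      omega
  have hmul : s * (3 + q) = 3 * s + s * q := by ring
  have hmul2 : s * (2 + q) = 2 * s + s * q := by ring
  have h := le_crc_cyclicPartition (n := s * (3 + q) + r) (N := s * (3 + q) + r) (t := s) hs le_rfl
    le_rfl (by omega) (fun p => if p < r then s * (3 + q) + p else s * (2 + q) + p) ?_ D ?_
  · rw [hDcard] at h
    refine le_trans (le_of_eq ?_) h
    rw [show s * (3 + q) + r - 2 * s = s + s * q + r by omega]
    have h1 := choose_two_cast s
    have h2 := choose_two_cast r
    have h3 := choose_two_cast (s - r)
    zify [hr.le, Nat.one_le_of_lt hs] at h1 h2 h3 ⊢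
    nlinarith
  · intro p hp
    refine ⟨?_, ?_⟩
    · split_ifs <;> rw [Nat.mul_add_mod, Nat.mod_eq_of_lt hp]
    · split_ifs <;> omega
  · intro p hp
    simp only [D, Finset.mem_union, mem_ltPairs, Finset.mem_image] at hp
    rcases hp with hp | ⟨p', hp', rfl⟩
    · rw [if_pos hp.2, if_pos (by omega)]
      omega
    · simp only
      rw [if_neg (by omega), if_neg (by omega)]
      omega

lemma le_crc_cyclicPartition_odd {n t : ℕ} (hn : 3 * t + 2 ≤ n) :
    6 * t.choose 2 + 2 * t ≤ crc (cyclicPartition n (t + 1) (3 * t + 2)) := by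
  have h := le_crc_cyclicPartition (n := n) (s := t + 1) (N := 3 * t + 2) (t := t) (by omega) hn
    (by omega) (by omega) (fun p => (t + 1) * 2 + p) ?_ (ltPairs t) ?_
  · refine le_trans (le_of_eq ?_) h
    rw [card_ltPairs, show 3 * t + 2 - 2 * (t + 1) = t by omega, Nat.add_sub_cancel]
    have h1 := choose_two_cast t
    have h2 := choose_two_cast (t + 1)
    zify
    push_cast at h2
    linarith
  · intro p hp
    refine ⟨?_, by omega⟩
    rw [Nat.mul_add_mod, Nat.mod_eq_of_lt (by omega)]
  · intro p hp
    rw [mem_ltPairs] at hp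
    omega

lemma le_crc_cyclicPartition_even {n t : ℕ} (ht : 0 < t) (hn : 3 * t ≤ n) :
    6 * t.choose 2 ≤ crc (cyclicPartition n t (3 * t)) := by
  have h := le_crc_cyclicPartition (n := n) (s := t) (N := 3 * t) (t := t) ht hn
    le_rfl (by omega) (fun p => t * 2 + p) ?_ (ltPairs t) ?_
  · refine le_trans (le_of_eq ?_) h
    rw [card_ltPairs, show 3 * t - 2 * t = t by omega]
    have h1 := choose_two_cast t
    zify [Nat.one_le_of_lt ht]
    linarith
  · intro p hp
    refine ⟨?_, by omega⟩
    rw [Nat.mul_add_mod, Nat.mod_eq_of_lt (by omega)]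
  · intro p hp
    rw [mem_ltPairs] at hp
    omega

lemma le_crc_cyclicPartition_pairs {n a : ℕ} (hn : 2 * a ≤ n) :
    a.choose 2 ≤ crc (cyclicPartition n a (2 * a)) := by
  rcases Nat.eq_zero_or_pos a with rfl | ha
  · simp
  have h := le_crc_cyclicPartition (n := n) (s := a) (N := 2 * a) (t := 0) ha hn
    (by omega) (by omega) id (by simp) ∅ (by simp)
  simpa using h

/-- The maximum value of the circular crossing number on `Π_n^k`. -/
theorem max_crc_blocks (n k : ℕ) (hk : 1 ≤ k) (hkn : k ≤ n) :
    (3 * k ≤ n →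
      IsGreatest {c : ℕ | ∃ π : Finpartition (univ : Finset (Fin n)),
          π.parts.card = k ∧ crc π = c}
        ((k - 1) * n - (n % k) * (k - n % k)) ∧
      (k - 1) * n - (n % k) * (k - n % k)
        = 2 * k.choose 2 * (n / k) + 2 * (n % k).choose 2) ∧
    ((n ≤ 3 * k ∧ 2 * k < n) ∨ (n ≤ 2 * k ∧ k + 6 ≤ n) →
      IsGreatest {c : ℕ | ∃ π : Finpartition (univ : Finset (Fin n)),
          π.parts.card = k ∧ crc π = c}
        (6 * ((n - k) / 2).choose 2
          + if (n - k) % 2 = 1 then 2 * ((n - k) / 2) else 0)) ∧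
    (n ≤ k + 5 ∧ n ≤ 2 * k →
      IsGreatest {c : ℕ | ∃ π : Finpartition (univ : Finset (Fin n)),
          π.parts.card = k ∧ crc π = c}
        ((n - k).choose 2)) := by
  have hgreatest : ∀ {s N v : ℕ}, s ≤ N → (N = 0 ∨ 0 < s) → N ≤ n → s + (n - N) = k →
      v ≤ crc (cyclicPartition n s N) →
      (∀ π : Finpartition (univ : Finset (Fin n)), π.parts.card = k → crc π ≤ v) →
      IsGreatest {c : ℕ | ∃ π : Finpartition (univ : Finset (Fin n)),
          π.parts.card = k ∧ crc π = c} v := by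
    intro s N v h1 h2 h3 h4 h5 h6
    have hcard := (card_cyclicPartition_parts h1 h2 h3).trans h4
    refine ⟨⟨_, hcard, le_antisymm (h6 _ hcard) h5⟩, ?_⟩
    rintro c ⟨π, hπ, rfl⟩
    exact h6 π hπ
  refine ⟨fun h3 => ?_, fun hb => ?_, fun hc => ?_⟩
  · have hval : (k - 1) * n - (n % k) * (k - n % k) =
        2 * k.choose 2 * (n / k) + 2 * (n % k).choose 2 := by
      have hr := Nat.mod_lt n hk
      have hn := Nat.div_add_mod n k
      have h1 := choose_two_cast k
      have h2 := choose_two_cast (n % k)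
      apply Nat.sub_eq_of_eq_add
      zify [hr.le, hk] at hn ⊢
      push_cast at h2 hn ⊢
      linear_combination (-(k : ℤ) + 1) * hn - ((n : ℤ) / k) * h1 - h2
    refine ⟨hgreatest (s := k) (N := n) hkn (Or.inr hk) le_rfl (by omega) ?_ ?_, hval⟩
    · rw [hval]
      exact le_crc_cyclicPartition_balanced hk h3
    · rintro π rfl
      exact crc_le_balanced π hk
  · have hupper : ∀ π : Finpartition (univ : Finset (Fin n)), π.parts.card = k →
        crc π ≤ 6 * ((n - k) / 2).choose 2 +
          if (n - k) % 2 = 1 then 2 * ((n - k) / 2) else 0 := by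
      rintro π hπ
      obtain ⟨x, y, b, h1, h2, h3, h4⟩ := crc_le_small_blocks π
      rw [hπ] at h2 h3
      have ha : n - k = b + y := by omega
      rw [ha]
      rcases Nat.lt_or_ge (b + y) 4 with h5 | h5
      · have h6 := small_blocks_bound_triples_of_lt h1 h2 (by omega) (by omega) h5
        zify at h6 ⊢
        linarith
      · have h6 := small_blocks_bound_triples h1 h5
        zify at h6 ⊢
        linarith
    rcases Nat.mod_two_eq_zero_or_one (n - k) with h | h
    · refine hgreatest (s := (n - k) / 2) (N := 3 * ((n - k) / 2)) (by omega) (by omega) (by omega)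
        (by omega) ?_ hupper
      rw [if_neg (by omega), add_zero]
      exact le_crc_cyclicPartition_even (by omega) (by omega)
    · refine hgreatest (s := (n - k) / 2 + 1) (N := 3 * ((n - k) / 2) + 2) (by omega) (by omega)
        (by omega) (by omega) ?_ hupper
      rw [if_pos h]
      exact le_crc_cyclicPartition_odd (by omega)
  · refine hgreatest (s := n - k) (N := 2 * (n - k)) (by omega) (by omega) (by omega) (by omega)
      (le_crc_cyclicPartition_pairs (by omega)) ?_
    intro π hπ
    obtain ⟨x, y, b, h1, h2, h3, h4⟩ := crc_le_small_blocks π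
    have h6 := small_blocks_bound_pairs h1 (show b + y ≤ 5 by omega)
    rw [show n - k = b + y by omega]
    zify
    linarith
end

section
/- For every integer n ≥ 1, the maximum of cr^ℓ(π) over all set partitions π of [n] equals ⌊(1/3)·C(n−1,2)⌋. -/
open Finset

theorem two_mul_sum_min_add (s j : ℕ) :
    2 * ∑ r ∈ range (s + j), min r s = s * (s - 1) + 2 * s * j := by
  induction j with
  | zero =>
    have h : ∑ r ∈ range s, min r s = ∑ r ∈ range s, r :=
      sum_congr rfl fun r hr => min_eq_left (mem_range.1 hr).le
    rw [add_zero, h, mul_comm, Finset.sum_range_id_mul_two]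
    simp
  | succ j ih =>
    rw [← add_assoc, sum_range_succ, mul_add, ih, min_eq_right (by omega)]
    ring

theorem six_mul_sum_min_le {m s N : ℕ} (h : m + s ≤ N) :
    6 * ∑ r ∈ range m, min r s ≤ N * (N - 1) := by
  refine le_trans ?_ (Nat.mul_le_mul h (Nat.sub_le_sub_right h 1))
  rcases le_total s m with hsm | hms
  · obtain ⟨j, rfl⟩ := Nat.exists_eq_add_of_le hsm
    have := two_mul_sum_min_add s j
    rcases s with _ | s
    · simp
    · have h1 : s + 1 + j + (s + 1) - 1 = 2 * s + j + 1 := by omega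
      rw [h1]
      simp only [Nat.add_sub_cancel] at this
      rcases lt_trichotomy j s with h | h | h
      · obtain ⟨d, rfl⟩ := Nat.exists_eq_add_of_lt h
        nlinarith
      · subst h
        nlinarith
      · obtain ⟨d, rfl⟩ := Nat.exists_eq_add_of_lt h
        have := Nat.le_mul_self d
        nlinarith
  · have h1 : ∑ r ∈ range m, min r s = ∑ r ∈ range m, r :=
      sum_congr rfl fun r hr => min_eq_left ((mem_range.1 hr).le.trans hms)
    have h2 := Finset.sum_range_id_mul_two m
    rw [h1]
    rcases m with _ | m
    · simp
    · obtain ⟨d, rfl⟩ := Nat.exists_eq_add_of_le hms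
      have h3 : m + 1 + (m + 1 + d) - 1 = 2 * m + 1 + d := by omega
      rw [h3]
      simp only [Nat.add_sub_cancel] at h2
      nlinarith

/-- Summing over a finite set the truncated number of larger elements. -/
theorem sum_min_card_filter_lt {α : Type*} [LinearOrder α] (C : Finset α) (s : ℕ) :
    ∑ b ∈ C, min (#{d ∈ C | b < d}) s = ∑ r ∈ range #C, min r s := by
  induction C using Finset.induction_on_min with
  | empty => simp
  | insert a C ha ih =>
    have haC : a ∉ C := fun h => lt_irrefl _ (ha a h)
    rw [sum_insert haC, card_insert_of_notMem haC, sum_range_succ, ← ih, add_comm]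
    congr 1
    · refine sum_congr rfl fun b hb => ?_
      rw [filter_insert, if_neg (ha b hb).not_gt]
    · rw [filter_insert, if_neg (lt_irrefl a), filter_true_of_mem ha]

section Arcs

variable {n : ℕ} {π : Finpartition (univ : Finset (Fin n))}

theorem sameBlock_iff {a b : Fin n} : sameBlock π a b ↔ π.part a = π.part b := by
  constructor
  · rintro ⟨B, hB, ha, hb⟩
    rw [π.part_eq_of_mem hB ha, π.part_eq_of_mem hB hb]
  · intro h
    exact ⟨π.part a, π.part_mem.2 (mem_univ a), π.mem_part (mem_univ a),
      h ▸ π.mem_part (mem_univ b)⟩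

theorem IsArc.part_eq {a b : Fin n} (h : IsArc π a b) : π.part a = π.part b :=
  sameBlock_iff.1 h.2.1

theorem IsArc.le_left {a b c : Fin n} (h : IsArc π a b) (hcb : c < b)
    (hc : π.part c = π.part b) : c ≤ a :=
  not_lt.1 fun hac => h.2.2 c hac hcb (sameBlock_iff.2 (h.part_eq.trans hc.symm))

theorem IsArc.left_unique {a a' b : Fin n} (h : IsArc π a b) (h' : IsArc π a' b) : a = a' :=
  le_antisymm (h'.le_left h.1 h.part_eq) (h.le_left h'.1 h'.part_eq)

theorem exists_isArc {c b : Fin n} (hcb : c < b) (hc : π.part c = π.part b) :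
    ∃ a, IsArc π a b := by
  classical
  let S : Finset (Fin n) := {x | x < b ∧ π.part x = π.part b}
  have hS : S.Nonempty := ⟨c, by simp [S, hcb, hc]⟩
  have hm := S.max'_mem hS
  simp only [S, mem_filter, mem_univ, true_and] at hm
  refine ⟨S.max' hS, hm.1, sameBlock_iff.2 hm.2, fun x hx hxb hs => ?_⟩
  have : x ∈ S := by
    simp only [S, mem_filter, mem_univ, true_and]
    exact ⟨hxb, (sameBlock_iff.1 hs).symm.trans hm.2⟩
  exact (S.le_max' x this).not_gt hx

variable (π) in
open Classical in
/-- The right endpoints of the arcs of `π`. -/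
noncomputable def closers : Finset (Fin n) := {b | ∃ a, IsArc π a b}

variable (π) in
open Classical in
/-- The right endpoints of the arcs whose crossing with an arc ending at `b` lies left of `b`. -/
noncomputable def crossingClosers (b : Fin n) : Finset (Fin n) :=
  {d | b < d ∧ ∃ a c, IsArc π a b ∧ IsArc π c d ∧ a < c ∧ c < b}

theorem card_closers_add_card_parts_le : #(closers π) + #π.parts ≤ n := by
  classical
  have h : #π.parts ≤ #(closers π)ᶜ := by
    refine card_le_card_of_surjOn π.part fun B hB => ?_
    have hne := π.nonempty_of_mem_parts hB
    have hmin := B.min'_mem hne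
    refine ⟨B.min' hne, ?_, π.part_eq_of_mem hB hmin⟩
    simp only [closers, coe_compl, Set.mem_compl_iff, mem_coe, mem_filter, mem_univ, true_and]
    rintro ⟨a, ha⟩
    have haB : a ∈ B := by
      rw [← π.part_eq_of_mem hB hmin, ← ha.part_eq]
      exact π.mem_part (mem_univ a)
    exact (B.min'_le a haB).not_gt ha.1
  have := card_add_card_compl (closers π)
  rw [Fintype.card_fin] at this
  omega

theorem card_crossingClosers_le_filter (b : Fin n) :
    #(crossingClosers π b) ≤ #{d ∈ closers π | b < d} := by
  classical
  refine card_le_card fun d hd => ?_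
  simp only [crossingClosers, closers, mem_filter, mem_univ, true_and] at hd ⊢
  obtain ⟨hbd, a, c, -, hc, -⟩ := hd
  exact ⟨⟨c, hc⟩, hbd⟩

theorem card_crossingClosers_le_parts (b : Fin n) :
    #(crossingClosers π b) ≤ #π.parts - 1 := by
  classical
  rw [← card_erase_of_mem (π.part_mem.2 (mem_univ b))]
  refine card_le_card_of_injOn π.part (fun d hd => ?_) fun d hd d' hd' h => ?_
  · simp only [crossingClosers, coe_filter, mem_univ, true_and, Set.mem_ofPred_eq] at hd
    obtain ⟨hbd, a, c, -, hc, -, hcb⟩ := hd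
    exact mem_erase.2 ⟨fun h => (hc.le_left hbd h.symm).not_gt hcb, π.part_mem.2 (mem_univ d)⟩
  · simp only [crossingClosers, coe_filter, mem_univ, true_and, Set.mem_ofPred_eq] at hd hd'
    obtain ⟨hbd, a, c, -, hc, -, hcb⟩ := hd
    obtain ⟨hbd', a', c', -, hc', -, hcb'⟩ := hd'
    rcases lt_trichotomy d d' with hlt | heq | hlt
    · exact absurd ((hc'.le_left hlt h).trans_lt hcb') hbd.not_gt
    · exact heq
    · exact absurd ((hc.le_left hlt h.symm).trans_lt hcb) hbd'.not_gt

theorem crl_le_sum_card_crossingClosers :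
    crl π ≤ ∑ b ∈ closers π, #(crossingClosers π b) := by
  classical
  rw [← card_sigma, ← Set.ncard_coe_finset]
  refine Set.ncard_le_ncard_of_injOn (fun q => ⟨q.1.2, q.2.2⟩) ?_ ?_ (Set.toFinite _)
  · rintro ⟨⟨a, b⟩, c, d⟩ ⟨h1, h2, h3, h4, h5⟩
    simp only [coe_sigma, Set.mem_sigma_iff, mem_coe, closers, crossingClosers, mem_filter,
      mem_univ, true_and]
    exact ⟨⟨a, h1⟩, h5, a, c, h1, h2, h3, h4⟩
  · rintro ⟨⟨a, b⟩, c, d⟩ ⟨h1, h2, -⟩ ⟨⟨a', b'⟩, c', d'⟩ ⟨h1', h2', -⟩ h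
    simp only [Sigma.mk.injEq, heq_eq_eq] at h h1 h2 h1' h2'
    obtain ⟨rfl, rfl⟩ := h
    rw [h1.left_unique h1', h2.left_unique h2']

theorem crl_le (π : Finpartition (univ : Finset (Fin n))) (hn : 1 ≤ n) :
    crl π ≤ (n - 1).choose 2 / 3 := by
  have hsum : crl π ≤ ∑ r ∈ range #(closers π), min r (#π.parts - 1) := by
    rw [← sum_min_card_filter_lt]
    exact crl_le_sum_card_crossingClosers.trans (sum_le_sum fun b _ =>
      le_min (card_crossingClosers_le_filter b) (card_crossingClosers_le_parts b))
  have hpos : 0 < #π.parts := card_pos.2 ⟨_, π.part_mem.2 (mem_univ (⟨0, hn⟩ : Fin n))⟩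
  have hcard := card_closers_add_card_parts_le (π := π)
  have h6 := six_mul_sum_min_le (m := #(closers π)) (s := #π.parts - 1) (N := n - 1) (by omega)
  rw [Nat.choose_two_right]
  omega

end Arcs

open Classical in
/-- The partition of `[n]` into residue classes modulo `k`. -/
noncomputable def modPartition (n k : ℕ) : Finpartition (univ : Finset (Fin n)) :=
  Finpartition.ofSetoid (Setoid.ker fun a : Fin n => (a : ℕ) % k)

theorem sameBlock_modPartition {n k : ℕ} {a b : Fin n} :
    sameBlock (modPartition n k) a b ↔ (a : ℕ) % k = b % k := by
  classical
  rw [sameBlock_iff, eq_comm, ← Finpartition.mem_part_iff_part_eq_part _ (mem_univ _) (mem_univ _),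
    modPartition, Finpartition.mem_part_ofSetoid_iff_rel]
  rfl

theorem isArc_modPartition {n k : ℕ} (hk : 0 < k) {a b : Fin n} (h : (a : ℕ) + k = b) :
    IsArc (modPartition n k) a b := by
  refine ⟨Fin.lt_def.2 (by omega), sameBlock_modPartition.2 (by rw [← h, Nat.add_mod_right]),
    fun c hac hcb hs => ?_⟩
  rw [sameBlock_modPartition] at hs
  rw [Fin.lt_def] at hac hcb
  have hd := (Nat.modEq_iff_dvd' hac.le).1 hs
  have := Nat.le_of_dvd (by omega) hd
  omega

theorem sum_min_le_crl_modPartition (n k : ℕ) (hk : 0 < k) :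
    ∑ r ∈ range (n - k), min r (k - 1) ≤ crl (modPartition n k) := by
  rcases Nat.eq_zero_or_pos n with rfl | hn
  · simp
  have : NeZero n := ⟨hn.ne'⟩
  have hcard : ∑ r ∈ range (n - k), min r (k - 1) =
      #((range (n - k)).sigma fun r => range (min r (k - 1))) := by
    simp [card_sigma]
  rw [hcard, ← Set.ncard_coe_finset]
  refine Set.ncard_le_ncard_of_injOn (fun p =>
    ((Fin.ofNat n (p.1 - 1 - p.2), Fin.ofNat n (p.1 - 1 - p.2 + k)),
      (Fin.ofNat n p.1, Fin.ofNat n (p.1 + k)))) ?_ ?_ (Set.toFinite _)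
  · rintro ⟨c, i⟩ h
    simp only [coe_sigma, Set.mem_sigma_iff, mem_coe, mem_range] at h
    have e1 : (c - 1 - i) % n = c - 1 - i := Nat.mod_eq_of_lt (by omega)
    have e2 : (c - 1 - i + k) % n = c - 1 - i + k := Nat.mod_eq_of_lt (by omega)
    have e3 : c % n = c := Nat.mod_eq_of_lt (by omega)
    have e4 : (c + k) % n = c + k := Nat.mod_eq_of_lt (by omega)
    refine ⟨isArc_modPartition hk ?_, isArc_modPartition hk ?_, ?_, ?_, ?_⟩ <;>
      simp only [Fin.lt_def, Fin.val_ofNat, e1, e2, e3, e4] <;> omega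
  · rintro ⟨c, i⟩ h ⟨c', i'⟩ h' heq
    simp only [coe_sigma, Set.mem_sigma_iff, mem_coe, mem_range] at h h'
    simp only [Prod.mk.injEq, Fin.ext_iff, Fin.val_ofNat] at heq
    have e1 : (c - 1 - i) % n = c - 1 - i := Nat.mod_eq_of_lt (by omega)
    have e1' : (c' - 1 - i') % n = c' - 1 - i' := Nat.mod_eq_of_lt (by omega)
    have e3 : c % n = c := Nat.mod_eq_of_lt (by omega)
    have e3' : c' % n = c' := Nat.mod_eq_of_lt (by omega)
    rw [e1, e1', e3, e3'] at heq
    obtain rfl : c = c' := heq.2.1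
    obtain rfl : i = i' := by omega
    rfl

theorem choose_two_div_three_le_sum_min (n : ℕ) (hn : 1 ≤ n) :
    (n - 1).choose 2 / 3 ≤ ∑ r ∈ range (n - (n + 2) / 3), min r ((n + 2) / 3 - 1) := by
  rw [Nat.choose_two_right]
  obtain ⟨j, hj | hj | hj⟩ : ∃ j, n = 3 * j + 1 ∨ n = 3 * j + 2 ∨ n = 3 * j + 3 :=
    ⟨(n - 1) / 3, by omega⟩
  all_goals
    subst hj
  · have h := two_mul_sum_min_add j j
    have e1 : 3 * j + 1 - (3 * j + 1 + 2) / 3 = j + j := by omega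
    have e2 : (3 * j + 1 + 2) / 3 - 1 = j := by omega
    rw [e1, e2]
    have : (3 * j + 1 - 1) * (3 * j + 1 - 1 - 1) = 3 * (j * (j - 1) + 2 * j * j) := by
      rcases j with _ | j
      · rfl
      · have : 3 * (j + 1) + 1 - 1 - 1 = 3 * j + 2 := by omega
        rw [this]
        simp only [Nat.add_sub_cancel]
        ring
    omega
  · have h := two_mul_sum_min_add j (j + 1)
    have e1 : 3 * j + 2 - (3 * j + 2 + 2) / 3 = j + (j + 1) := by omega
    have e2 : (3 * j + 2 + 2) / 3 - 1 = j := by omega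
    rw [e1, e2]
    have : (3 * j + 2 - 1) * (3 * j + 2 - 1 - 1) = 3 * (j * (j - 1) + 2 * j * (j + 1)) := by
      rcases j with _ | j
      · rfl
      · have e3 : 3 * (j + 1) + 2 - 1 = 3 * j + 4 := by omega
        rw [e3]
        simp only [Nat.add_sub_cancel]
        have e4 : 3 * j + 4 - 1 = 3 * j + 3 := by omega
        rw [e4]
        ring
    omega
  · have h := two_mul_sum_min_add j (j + 2)
    have e1 : 3 * j + 3 - (3 * j + 3 + 2) / 3 = j + (j + 2) := by omega
    have e2 : (3 * j + 3 + 2) / 3 - 1 = j := by omega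
    rw [e1, e2]
    have : (3 * j + 3 - 1) * (3 * j + 3 - 1 - 1) = 3 * (j * (j - 1) + 2 * j * (j + 2)) + 2 := by
      have e3 : 3 * j + 3 - 1 = 3 * j + 2 := by omega
      have e4 : 3 * j + 2 - 1 = 3 * j + 1 := by omega
      rw [e3, e4]
      rcases j with _ | j
      · rfl
      · simp only [Nat.add_sub_cancel]
        ring
    omega

/-- The maximum value of the linear crossing number on `Π_n` is `⌊C(n-1,2)/3⌋`. -/
theorem max_crl (n : ℕ) (hn : 1 ≤ n) :
    IsGreatest {c : ℕ | ∃ π : Finpartition (univ : Finset (Fin n)), crl π = c}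
      ((n - 1).choose 2 / 3) := by
  refine ⟨⟨modPartition n ((n + 2) / 3), le_antisymm (crl_le _ hn) ?_⟩, ?_⟩
  · exact (choose_two_div_three_le_sum_min n hn).trans
      (sum_min_le_crl_modPartition n _ (by omega))
  · rintro _ ⟨π, rfl⟩
    exact crl_le π hn
end
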